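/- arXiv:1107.0563 — 3 statements merged into one kernel-verified Lean document; each statement's English description precedes it below -/
import Mathlib

section
/- Let A be a generic set on a property C of finitely generated squarefree monomial ideals of S_∞ = K[x_1, x_2, …]. Suppose that for all I, J ∈ I(C) one has pd_{K[X(I)]} K[X(I)]/(I ∩ K[X(I)]) = pd_{K[X(J)]} K[X(J)]/(J ∩ K[X(J)]), and that ara(I ∩ K[X(I)]) = pd_{K[X(I)]} K[X(I)]/(I ∩ K[X(I)]) for all I ∈ A. Then ara(I ∩ K[X(I)]) = pd_{K[X(I)]} K[X(I)]/(I ∩ K[X(I)]) holds for all I ∈ I(C). -/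
open CategoryTheory MvPolynomial

universe u

variable (K : Type u) [Field K]

/-- The squarefree monomial with support `A` in `K[x_0, x_1, …]`. -/
noncomputable def sqfMon (A : Finset ℕ) : MvPolynomial ℕ K :=
  ∏ i ∈ A, X i

/-- `I` is a finitely generated squarefree monomial ideal of
`S_∞ = K[x_0, x_1, …]`. -/
def IsFGSqfMonIdeal (I : Ideal (MvPolynomial ℕ K)) : Prop :=
  ∃ 𝒜 : Finset (Finset ℕ), I = Ideal.span ((fun A => sqfMon K A) '' ↑𝒜)

/-- The supports of the minimal monomial generators `G(I)` of a squarefree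
monomial ideal `I`. -/
def minSupp (I : Ideal (MvPolynomial ℕ K)) : Set (Finset ℕ) :=
  {A | sqfMon K A ∈ I ∧ ∀ B : Finset ℕ, B ⊂ A → sqfMon K B ∉ I}

/-- `μ(I)`: the number of minimal monomial generators. -/
noncomputable def muI (I : Ideal (MvPolynomial ℕ K)) : ℕ :=
  (minSupp K I).ncard

/-- `X(I)`: the set of variables appearing in the minimal monomial
generators of `I`. -/
def varSet (I : Ideal (MvPolynomial ℕ K)) : Set ℕ :=
  ⋃ A ∈ minSupp K I, (↑A : Set ℕ)

/-- The hypergraph `H(I)`, with vertex set `G(I)` (identified with the set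
`minSupp K I` of supports of minimal generators): faces are the nonempty
sets of generators divisible by a fixed variable. -/
def hypI (I : Ideal (MvPolynomial ℕ K)) : Set (Set (Finset ℕ)) :=
  {F | F.Nonempty ∧ ∃ x : ℕ, F = {A ∈ minSupp K I | x ∈ A}}

/-- The relation of Definition 5.1(2): the ideal `J` is obtained from
`I ∈ 𝒜` by substituting pairwise coprime squarefree monomials `M x` (in the
variables `X(J)`, possibly trivial) for the variables `x ∈ X(I)`; on supports
this means a bijection `σ` of `G(I)` with `G(J)` such that the support of
`σ A` is the disjoint union of the `M x`, `x ∈ A`. -/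
def Connects (I J : Ideal (MvPolynomial ℕ K)) : Prop :=
  ∃ (σ : Finset ℕ → Finset ℕ) (M : ℕ → Finset ℕ),
    Set.BijOn σ (minSupp K I) (minSupp K J) ∧
    (∀ x ∈ varSet K I, ∀ y ∈ varSet K I, x ≠ y → Disjoint (M x) (M y)) ∧
    (∀ x ∈ varSet K I, (↑(M x) : Set ℕ) ⊆ varSet K J) ∧
    (∀ A ∈ minSupp K I, σ A = A.biUnion M)

/-- `𝒜` is a generic set on the property `C` (a set of ideals): every member
is a finitely generated squarefree monomial ideal satisfying `C`, and every
finitely generated squarefree monomial ideal satisfying `C` arises from some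
member of `𝒜` by the substitution relation `Connects`. -/
def IsGenericSet (C 𝒜 : Set (Ideal (MvPolynomial ℕ K))) : Prop :=
  (∀ I ∈ 𝒜, IsFGSqfMonIdeal K I ∧ I ∈ C) ∧
  (∀ J, IsFGSqfMonIdeal K J → J ∈ C → ∃ I ∈ 𝒜, Connects K I J)

/-- A generic set is minimal if no proper subset is a generic set. -/
def IsMinimalGenericSet (C 𝒜 : Set (Ideal (MvPolynomial ℕ K))) : Prop :=
  IsGenericSet K C 𝒜 ∧ ∀ 𝒜' ⊆ 𝒜, IsGenericSet K C 𝒜' → 𝒜' = 𝒜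

/-- The projective dimension (possibly `⊤`) of a module `M` over a commutative
ring `R`, via the standard characterization by vanishing of `Ext` groups. -/
noncomputable def pdim (R : Type u) [CommRing R] (M : ModuleCat.{u} R) : ℕ∞ :=
  sInf {n : ℕ∞ | ∀ k : ℕ, n < (k : ℕ∞) → ∀ N : ModuleCat.{u} R,
    Subsingleton (((Ext R (ModuleCat.{u} R) k).obj (Opposite.op M)).obj N)}

/-- The arithmetical rank of an ideal. -/
noncomputable def ara {R : Type*} [CommRing R] (I : Ideal R) : ℕ :=
  sInf {r : ℕ | ∃ a : Fin r → R, (Ideal.span (Set.range a)).radical = I.radical}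

/-- `I ∩ K[X(I)]`: the restriction of `I` to the polynomial ring in the
variables appearing in its minimal generators. -/
noncomputable def restrictIdeal (I : Ideal (MvPolynomial ℕ K)) :
    Ideal (MvPolynomial (varSet K I) K) :=
  Ideal.comap (MvPolynomial.rename (Subtype.val : varSet K I → ℕ)) I

/-- `pd_{K[X(I)]} K[X(I)]/(I ∩ K[X(I)])`. -/
noncomputable def pdRestrict (I : Ideal (MvPolynomial ℕ K)) : ℕ∞ :=
  pdim (MvPolynomial (varSet K I) K)
    (ModuleCat.of (MvPolynomial (varSet K I) K)
      (MvPolynomial (varSet K I) K ⧸ restrictIdeal K I))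

section SimplexComplex

variable {ι : Type*} [LinearOrder ι]

/-- The sign attached to removing `i` from the face `S`. -/
def eraseSign (R : Type*) [CommRing R] (S : Finset ι) (i : ι) : R :=
  (-1) ^ (S.filter (· < i)).card

variable {R : Type*} [CommRing R]

lemma eraseSign_mul_self (S : Finset ι) (i : ι) : eraseSign R S i * eraseSign R S i = 1 := by
  rw [eraseSign, ← mul_pow]; simp

lemma eraseSign_erase_of_le {S : Finset ι} {i j : ι} (h : i ≤ j) :
    eraseSign R (S.erase j) i = eraseSign R S i := by
  have : (S.erase j).filter (· < i) = S.filter (· < i) := by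
    ext x
    simp only [Finset.mem_filter, Finset.mem_erase]
    refine ⟨fun hx => ⟨hx.1.2, hx.2⟩, fun hx => ⟨⟨?_, hx.1⟩, hx.2⟩⟩
    exact (hx.2.trans_le h).ne
  rw [eraseSign, this, eraseSign]

lemma eraseSign_erase_of_lt {S : Finset ι} {i j : ι} (hi : i ∈ S) (h : i < j) :
    eraseSign R (S.erase i) j = -eraseSign R S j := by
  have hi' : i ∈ S.filter (· < j) := by simp [hi, h]
  have h2 : (S.erase i).filter (· < j) = (S.filter (· < j)).erase i := by
    ext x
    simp only [Finset.mem_filter, Finset.mem_erase]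
    tauto
  rw [eraseSign, eraseSign, h2, ← Finset.card_erase_add_one hi', pow_succ]
  ring

lemma eraseSign_mul_erase_comm {S : Finset ι} {i j : ι} (hi : i ∈ S) (hj : j ∈ S) (hij : i ≠ j) :
    eraseSign R S i * eraseSign R (S.erase i) j =
      -(eraseSign R S j * eraseSign R (S.erase j) i) := by
  rcases lt_or_gt_of_ne hij with h | h
  · rw [eraseSign_erase_of_lt hi h, eraseSign_erase_of_le h.le]; ring
  · rw [eraseSign_erase_of_lt hj h, eraseSign_erase_of_le h.le]; ring

variable {N : Type*} [AddCommGroup N] [Module R N]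

/-- The coboundary on `N`-valued functions of the faces of a simplex, with weights `c`. -/
def coboundary (c : Finset ι → ι → R) (f : Finset ι → N) (S : Finset ι) : N :=
  ∑ i ∈ S, (eraseSign R S i * c S i) • f (S.erase i)

/-- Compatibility of the weights: removing two vertices in either order has the same weight. -/
def WeightsCommute (c : Finset ι → ι → R) : Prop :=
  ∀ S : Finset ι, ∀ i ∈ S, ∀ j ∈ S, i ≠ j →
    c S i * c (S.erase i) j = c S j * c (S.erase j) i

lemma coboundary_coboundary {c : Finset ι → ι → R} (hc : WeightsCommute c) (f : Finset ι → N)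
    (S : Finset ι) : coboundary c (coboundary c f) S = 0 := by
  simp only [coboundary, Finset.smul_sum]
  rw [Finset.sum_sigma']
  refine Finset.sum_involution (fun p _ => ⟨p.2, p.1⟩) ?_ ?_ ?_ ?_
  · rintro ⟨i, j⟩ h
    simp only [Finset.mem_sigma, Finset.mem_erase] at h
    obtain ⟨hi, hji, hj⟩ := h
    simp only [smul_smul, Finset.erase_right_comm (a := j) (b := i)]
    rw [← add_smul]
    have h1 := eraseSign_mul_erase_comm (R := R) hi hj hji.symm
    have h2 := hc S i hi j hj hji.symm
    convert zero_smul R _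
    linear_combination (c S i * c (S.erase i) j) * h1 -
      eraseSign R S j * eraseSign R (S.erase j) i * h2
  · rintro ⟨i, j⟩ h _ heq
    simp only [Finset.mem_sigma, Finset.mem_erase] at h
    simp only [Sigma.mk.injEq, heq_eq_eq] at heq
    exact h.2.1 heq.1
  · rintro ⟨i, j⟩ h
    simp only [Finset.mem_sigma, Finset.mem_erase] at h ⊢
    exact ⟨h.2.2, h.2.1.symm, h.1⟩
  · rintro ⟨i, j⟩ h
    rfl

lemma map_coboundary {N' : Type*} [AddCommGroup N'] [Module R N'] (φ : N →ₗ[R] N')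
    (c : Finset ι → ι → R) (f : Finset ι → N) (S : Finset ι) :
    φ (coboundary c f S) = coboundary c (fun S => φ (f S)) S := by
  simp [coboundary]

/-- The boundary map of the simplex with weights `c`. -/
noncomputable def boundary (c : Finset ι → ι → R) : (Finset ι →₀ R) →ₗ[R] (Finset ι →₀ R) :=
  Finsupp.linearCombination R (coboundary c fun S => Finsupp.single S 1)

lemma boundary_single_one (c : Finset ι → ι → R) (S : Finset ι) :
    boundary c (Finsupp.single S 1) = coboundary c (fun S => Finsupp.single S 1) S := by
  simp [boundary]

lemma boundary_boundary {c : Finset ι → ι → R} (hc : WeightsCommute c) (y : Finset ι →₀ R) :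
    boundary c (boundary c y) = 0 := by
  have : (boundary c).comp (boundary c) = 0 := by
    refine Finsupp.lhom_ext' fun S => LinearMap.ext_ring ?_
    simp only [LinearMap.comp_apply, Finsupp.lsingle_apply, boundary_single_one, map_coboundary,
      LinearMap.zero_apply]
    exact coboundary_coboundary hc _ S
  exact LinearMap.congr_fun this y

variable (R) in
/-- The chains of degree `k`. -/
abbrev chainsOfCard (ι : Type*) (k : ℕ) : Submodule R (Finset ι →₀ R) :=
  Finsupp.supported R R {S | S.card = k}

omit [LinearOrder ι] in
lemma single_mem_chainsOfCard {S : Finset ι} {k : ℕ} (h : S.card = k) (r : R) :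
    Finsupp.single S r ∈ chainsOfCard R ι k :=
  Finsupp.single_mem_supported R r h

lemma coboundary_mem_of_forall (c : Finset ι → ι → R) {f : Finset ι → N} {S : Finset ι}
    {P : Submodule R N} (h : ∀ i ∈ S, f (S.erase i) ∈ P) : coboundary c f S ∈ P :=
  Submodule.sum_mem _ fun i hi => Submodule.smul_mem _ _ (h i hi)

omit [LinearOrder ι] in
lemma map_mem_of_mem_chainsOfCard {φ : (Finset ι →₀ R) →ₗ[R] N} {P : Submodule R N} {k : ℕ}
    (h : ∀ S : Finset ι, S.card = k → φ (Finsupp.single S 1) ∈ P) {y : Finset ι →₀ R}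
    (hy : y ∈ chainsOfCard R ι k) : φ y ∈ P := by
  rw [chainsOfCard, Finsupp.supported_eq_span_single] at hy
  induction hy using Submodule.span_induction with
  | mem x hx => obtain ⟨S, hS, rfl⟩ := hx; exact h S hS
  | zero => simp
  | add x y _ _ hx hy => rw [map_add]; exact add_mem hx hy
  | smul a x _ hx => rw [map_smul]; exact P.smul_mem _ hx

lemma boundary_mem_chainsOfCard (c : Finset ι → ι → R) {k : ℕ} {y : Finset ι →₀ R}
    (hy : y ∈ chainsOfCard R ι (k + 1)) : boundary c y ∈ chainsOfCard R ι k := by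
  refine map_mem_of_mem_chainsOfCard (fun S hS => ?_) hy
  rw [boundary_single_one]
  refine coboundary_mem_of_forall _ fun i hi => single_mem_chainsOfCard ?_ _
  rw [Finset.card_erase_of_mem hi, hS, Nat.add_sub_cancel]

lemma boundary_eq_zero_of_mem_chainsOfCard_zero (c : Finset ι → ι → R) {y : Finset ι →₀ R}
    (hy : y ∈ chainsOfCard R ι 0) : boundary c y = 0 := by
  rw [← Submodule.mem_bot R]
  refine map_mem_of_mem_chainsOfCard (fun S hS => ?_) hy
  obtain rfl := Finset.card_eq_zero.1 hS
  simp [boundary_single_one, coboundary]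

/-- Adjoining the vertex `v`, a contracting homotopy when the weights of `v` are units. -/
noncomputable def coneMap (R : Type*) [CommRing R] (v : ι) :
    (Finset ι →₀ R) →ₗ[R] (Finset ι →₀ R) :=
  Finsupp.linearCombination R fun S =>
    if v ∈ S then 0 else Finsupp.single (insert v S) (eraseSign R S v)

lemma coneMap_single (v : ι) (S : Finset ι) (r : R) :
    coneMap R v (Finsupp.single S r) =
      if v ∈ S then 0 else Finsupp.single (insert v S) (r * eraseSign R S v) := by
  simp only [coneMap, Finsupp.linearCombination_single]
  split_ifs <;> simp

lemma coneMap_mem_chainsOfCard (v : ι) {k : ℕ} {y : Finset ι →₀ R}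
    (hy : y ∈ chainsOfCard R ι k) : coneMap R v y ∈ chainsOfCard R ι (k + 1) := by
  refine map_mem_of_mem_chainsOfCard (fun S hS => ?_) hy
  rw [coneMap_single]
  split_ifs with h
  · exact zero_mem _
  · exact single_mem_chainsOfCard (by rw [Finset.card_insert_of_notMem h, hS]) _

lemma boundary_coneMap_add (a : ι → R) (v : ι) (y : Finset ι →₀ R) :
    boundary (fun _ => a) (coneMap R v y) + coneMap R v (boundary (fun _ => a) y) = a v • y := by
  have : (boundary (fun _ => a)).comp (coneMap R v) + (coneMap R v).comp (boundary (fun _ => a)) =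
      a v • LinearMap.id := by
    refine Finsupp.lhom_ext' fun S => LinearMap.ext_ring ?_
    simp only [LinearMap.comp_apply, Finsupp.lsingle_apply, LinearMap.add_apply,
      LinearMap.smul_apply, LinearMap.id_apply, boundary_single_one, map_coboundary]
    by_cases hv : v ∈ S
    · rw [coneMap_single, if_pos hv, map_zero, zero_add, coboundary, Finset.sum_eq_single v]
      · rw [coneMap_single, if_neg (by simp), Finset.insert_erase hv, one_mul,
          eraseSign_erase_of_le le_rfl, Finsupp.smul_single, Finsupp.smul_single]
        congr 1
        simp only [smul_eq_mul]
        linear_combination a v * eraseSign_mul_self (R := R) S v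
      · intro i _ hi
        rw [coneMap_single, if_pos (by simp [hv, hi.symm]), smul_zero]
      · exact fun h => absurd hv h
    · have hvS : eraseSign R (insert v S) v = eraseSign R S v := by
        rw [← eraseSign_erase_of_le (S := insert v S) (le_refl v), Finset.erase_insert hv]
      rw [coneMap_single, if_neg hv, one_mul, ← mul_one (eraseSign R S v), ← smul_eq_mul,
        ← Finsupp.smul_single, map_smul, boundary_single_one, coboundary, Finset.sum_insert hv,
        Finset.erase_insert hv, smul_add, add_assoc, coboundary, Finset.smul_sum,
        ← Finset.sum_add_distrib, Finset.sum_eq_zero, add_zero]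
      · rw [smul_smul, hvS]
        congr 1
        linear_combination a v * eraseSign_mul_self (R := R) S v
      · intro i hi
        have hiv : v ≠ i := fun h => hv (h ▸ hi)
        rw [coneMap_single, if_neg (by simp [hv]), ← Finset.erase_insert_of_ne hiv, one_mul,
          smul_smul, Finsupp.smul_single, Finsupp.smul_single, ← Finsupp.single_add]
        have h1 := eraseSign_mul_erase_comm (R := R) (Finset.mem_insert_self v S)
          (Finset.mem_insert_of_mem hi) hiv
        rw [Finset.erase_insert hv, hvS, Finset.erase_insert_of_ne hiv] at h1
        have h2 : eraseSign R (insert v (S.erase i)) v = eraseSign R (S.erase i) v := by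
          rw [← eraseSign_erase_of_le (S := insert v (S.erase i)) (le_refl v),
            Finset.erase_insert (by simp [hv])]
        rw [h2] at h1
        have h3 : eraseSign R (insert v S) i * eraseSign R S v +
          eraseSign R S i * eraseSign R (S.erase i) v = 0 := by
          linear_combination eraseSign R S v * eraseSign R (S.erase i) v * h1 -
            eraseSign R S i * eraseSign R (S.erase i) v * eraseSign_mul_self (R := R) S v -
            eraseSign R (insert v S) i * eraseSign R S v *
              eraseSign_mul_self (R := R) (S.erase i) v
        refine (congrArg _ ?_).trans (Finsupp.single_zero _)
        simp only [smul_eq_mul]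
        linear_combination a i * h3
  exact LinearMap.congr_fun this y

end SimplexComplex

section Lifting

variable {ι : Type*} [LinearOrder ι] {R : Type*} [CommRing R]

lemma WeightsCommute.pow {c : Finset ι → ι → R} (hc : WeightsCommute c) (t : ℕ) :
    WeightsCommute fun S i => c S i ^ t := by
  intro S i hi j hj hij
  simp only [← mul_pow, hc S i hi j hj hij]

lemma weightsCommute_const (a : ι → R) : WeightsCommute fun _ : Finset ι => a :=
  fun _ _ _ _ _ _ => mul_comm _ _

lemma coboundary_congr {N : Type*} [AddCommGroup N] [Module R N] {c : Finset ι → ι → R}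
    {f g : Finset ι → N} {S : Finset ι} (h : ∀ i ∈ S, f (S.erase i) = g (S.erase i)) :
    coboundary c f S = coboundary c g S :=
  Finset.sum_congr rfl fun i hi => by rw [h i hi]

lemma coboundary_empty {N : Type*} [AddCommGroup N] [Module R N] (c : Finset ι → ι → R)
    (f : Finset ι → N) : coboundary c f ∅ = 0 := by simp [coboundary]

lemma coboundary_add_smul {N : Type*} [AddCommGroup N] [Module R N] (c : Finset ι → ι → R)
    (f g : Finset ι → N) (s : R) (S : Finset ι) :
    coboundary c (fun S => f S + s • g S) S = coboundary c f S + s • coboundary c g S := by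
  simp only [coboundary, smul_add, Finset.sum_add_distrib, Finset.smul_sum]
  congr 1
  exact Finset.sum_congr rfl fun i _ => smul_comm _ _ _

/-- A linear map commutes with boundaries as soon as it does so on the basis. -/
lemma boundary_linearCombination {Y : Type*} [AddCommGroup Y] [Module R Y] (D : Y →ₗ[R] Y)
    {c : Finset ι → ι → R} {φ : Finset ι → Y} (h : ∀ S, D (φ S) = coboundary c φ S)
    (y : Finset ι →₀ R) :
    D (Finsupp.linearCombination R φ y) = Finsupp.linearCombination R φ (boundary c y) := by
  have : D.comp (Finsupp.linearCombination R φ) =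
      (Finsupp.linearCombination R φ).comp (boundary c) := by
    refine Finsupp.lhom_ext' fun S => LinearMap.ext_ring ?_
    simp only [LinearMap.comp_apply, Finsupp.lsingle_apply, boundary_single_one, map_coboundary,
      Finsupp.linearCombination_single, one_smul, h]
  exact LinearMap.congr_fun this y

/-- Multiplication by an element of `(a)` is null-homotopic on the Koszul complex of `a`. -/
lemma exists_boundary_eq_smul {a : ι → R} {x : R} [Finite ι]
    (hx : x ∈ Ideal.span (Set.range a)) {n : ℕ} {z : Finset ι →₀ R}
    (hz : z ∈ chainsOfCard R ι n) (hdz : boundary (fun _ => a) z = 0) :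
    ∃ w ∈ chainsOfCard R ι (n + 1), boundary (fun _ => a) w = x • z := by
  have := Fintype.ofFinite ι
  obtain ⟨b, rfl⟩ := (Submodule.mem_span_range_iff_exists_fun R).1 hx
  refine ⟨∑ i, b i • coneMap R i z,
    Submodule.sum_mem _ fun i _ => Submodule.smul_mem _ _ (coneMap_mem_chainsOfCard i hz), ?_⟩
  rw [map_sum, Finset.sum_smul]
  refine Finset.sum_congr rfl fun i _ => ?_
  have h := boundary_coneMap_add a i z
  rw [hdz, map_zero, add_zero] at h
  rw [map_smul, h, smul_smul, smul_eq_mul]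

/-- A comparison map from a power of a simplicial resolution to the Koszul complex of `a`,
when powers of the labels lie in the ideal generated by `a`. -/
lemma exists_map_to_koszul [Finite ι] {κ : Type*} [LinearOrder κ] [Finite κ] (a : κ → R)
    {m : Finset ι → R} {c : Finset ι → ι → R} (hc : WeightsCommute c)
    (hcm : ∀ S, ∀ i ∈ S, c S i * m (S.erase i) = m S) (hm0 : m ∅ = 1) {n : ℕ}
    (hm : ∀ S : Finset ι, S.Nonempty → m S ^ n ∈ Ideal.span (Set.range a)) :
    ∃ t : ℕ, ∃ φ : Finset ι → (Finset κ →₀ R), φ ∅ = Finsupp.single ∅ 1 ∧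
      (∀ S, φ S ∈ chainsOfCard R κ S.card) ∧
      ∀ S, boundary (fun _ => a) (φ S) = coboundary (fun S i => c S i ^ (t + 1)) φ S := by
  have := Fintype.ofFinite ι
  suffices H : ∀ N : ℕ, ∃ t : ℕ, ∃ φ : Finset ι → (Finset κ →₀ R), φ ∅ = Finsupp.single ∅ 1 ∧
      (∀ S, φ S ∈ chainsOfCard R κ S.card) ∧
      ∀ S, S.card ≤ N →
        boundary (fun _ => a) (φ S) = coboundary (fun S i => c S i ^ (t + 1)) φ S by
    obtain ⟨t, φ, h0, h1, h2⟩ := H (Fintype.card ι)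
    exact ⟨t, φ, h0, h1, fun S => h2 S (Finset.card_le_univ S)⟩
  intro N
  induction N with
  | zero =>
    refine ⟨0, fun S => if S = ∅ then Finsupp.single ∅ 1 else 0, if_pos rfl, fun S => ?_,
      fun S hS => ?_⟩
    · beta_reduce
      split_ifs with h
      · exact single_mem_chainsOfCard (by rw [h, Finset.card_empty, Finset.card_empty]) _
      · exact zero_mem _
    · obtain rfl := Finset.card_eq_zero.1 (Nat.le_zero.1 hS)
      beta_reduce
      rw [if_pos rfl, boundary_single_one, coboundary_empty, coboundary_empty]
  | succ N ih =>
    obtain ⟨t, φ, h0, h1, h2⟩ := ih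
    have key : ∀ S : Finset ι, S.card = N + 1 → ∃ w ∈ chainsOfCard R κ (N + 1),
        boundary (fun _ => a) w = m S ^ n • coboundary (fun S i => c S i ^ (t + 1)) φ S := by
      intro S hS
      refine exists_boundary_eq_smul (hm S (Finset.card_pos.1 (by lia))) ?_ ?_
      · refine coboundary_mem_of_forall _ fun i hi => ?_
        have := h1 (S.erase i)
        rwa [Finset.card_erase_of_mem hi, hS, Nat.add_sub_cancel] at this
      · rw [map_coboundary, ← coboundary_coboundary (hc.pow (t + 1)) φ S]
        refine coboundary_congr fun i hi => h2 _ ?_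
        rw [Finset.card_erase_of_mem hi, hS, Nat.add_sub_cancel]
    choose! w hw hdw using key
    have hcob : ∀ S : Finset ι, coboundary (fun S i => c S i ^ (t + n + 1))
        (fun S => m S ^ n • φ S) S = m S ^ n • coboundary (fun S i => c S i ^ (t + 1)) φ S := by
      intro S
      simp only [coboundary, Finset.smul_sum, smul_smul]
      refine Finset.sum_congr rfl fun i hi => ?_
      rw [← hcm S i hi]
      congr 1
      ring
    refine ⟨t + n, fun S => if S.card = N + 1 then w S else m S ^ n • φ S,
      by simp [h0, hm0], fun S => ?_, fun S hS => ?_⟩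
    · beta_reduce
      split_ifs with h
      · rw [h]; exact hw S h
      · exact Submodule.smul_mem _ _ (h1 S)
    · rw [coboundary_congr (g := fun S => m S ^ n • φ S), hcob]
      · beta_reduce
        split_ifs with h
        · exact hdw S h
        · rw [map_smul, h2 S (by lia)]
      · intro i hi
        refine if_neg ?_
        rw [Finset.card_erase_of_mem hi]
        have := Finset.card_pos.2 ⟨i, hi⟩
        lia

/-- Degree by degree construction of chain maps and homotopies out of a simplicial complex. -/
lemma exists_filler [Finite ι] {Y : Type*} [AddCommGroup Y] [Module R Y] (D : Y →ₗ[R] Y)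
    {c : Finset ι → ι → R} (hc : WeightsCommute c) (b : Finset ι → Y) (s : R) (y₀ : Y)
    {Q Q' : Submodule R Y} (hex : ∀ z ∈ Q, D z = 0 → ∃ w ∈ Q', D w = z) (h0 : D y₀ = b ∅)
    (hb : ∀ S : Finset ι, S.Nonempty → D (b S) + s • coboundary c b S = 0)
    (hQ : ∀ S : Finset ι, S.Nonempty → ∀ φ : Finset ι → Y, φ ∅ = y₀ →
      (∀ S : Finset ι, S.Nonempty → φ S ∈ Q') → b S + s • coboundary c φ S ∈ Q) :
    ∃ φ : Finset ι → Y, φ ∅ = y₀ ∧ (∀ S : Finset ι, S.Nonempty → φ S ∈ Q') ∧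
      ∀ S, D (φ S) = b S + s • coboundary c φ S := by
  have := Fintype.ofFinite ι
  suffices H : ∀ N : ℕ, ∃ φ : Finset ι → Y, φ ∅ = y₀ ∧ (∀ S : Finset ι, S.Nonempty → φ S ∈ Q') ∧
      ∀ S, S.card ≤ N → D (φ S) = b S + s • coboundary c φ S by
    obtain ⟨φ, h0, h1, h2⟩ := H (Fintype.card ι)
    exact ⟨φ, h0, h1, fun S => h2 S (Finset.card_le_univ S)⟩
  intro N
  induction N with
  | zero =>
    refine ⟨fun S => if S = ∅ then y₀ else 0, if_pos rfl, fun S hS => ?_, fun S hS => ?_⟩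
    · beta_reduce
      rw [if_neg hS.ne_empty]
      exact zero_mem _
    · obtain rfl := Finset.card_eq_zero.1 (Nat.le_zero.1 hS)
      beta_reduce
      rw [if_pos rfl, h0, coboundary_empty, smul_zero, add_zero]
  | succ N ih =>
    obtain ⟨φ, h0', h1, h2⟩ := ih
    have key : ∀ S : Finset ι, S.card = N + 1 → ∃ w ∈ Q', D w = b S + s • coboundary c φ S := by
      intro S hS
      have hne : S.Nonempty := Finset.card_pos.1 (by lia)
      refine hex _ (hQ S hne φ h0' h1) ?_
      rw [map_add, map_smul, map_coboundary, coboundary_congr (g := fun S => b S + s •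
        coboundary c φ S), coboundary_add_smul, coboundary_coboundary hc, smul_zero, add_zero,
        hb S hne]
      intro i hi
      refine h2 _ ?_
      rw [Finset.card_erase_of_mem hi, hS, Nat.add_sub_cancel]
    choose! w hw hdw using key
    have hcob : ∀ S : Finset ι, S.card ≤ N + 1 →
        coboundary c (fun S => if S.card = N + 1 then w S else φ S) S = coboundary c φ S := by
      intro S hS
      refine coboundary_congr fun i hi => if_neg ?_
      rw [Finset.card_erase_of_mem hi]
      have := Finset.card_pos.2 ⟨i, hi⟩
      lia
    refine ⟨fun S => if S.card = N + 1 then w S else φ S, by simp [h0'], fun S hS => ?_,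
      fun S hS => ?_⟩
    · beta_reduce
      split_ifs with h
      · exact hw S h
      · exact h1 S hS
    · rw [hcob S hS]
      beta_reduce
      split_ifs with h
      · exact hdw S h
      · exact h2 S (by lia)

/-- If `f` is a cocycle on a simplicial resolution of `R ⧸ J`, whose degree exceeds the number of
generators of an ideal `(a) ⊆ J` containing powers of the labels, then `f` becomes a coboundary
on some power of the resolution. -/
lemma exists_pow_smul_eq_coboundary [Finite ι] {κ : Type*} [LinearOrder κ] [Fintype κ]
    (a : κ → R) {J : Ideal R} (ha : ∀ j, a j ∈ J)
    {m : Finset ι → R} {c : Finset ι → ι → R} (hc : WeightsCommute c)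
    (hcm : ∀ S, ∀ i ∈ S, c S i * m (S.erase i) = m S) (hm0 : m ∅ = 1) {n : ℕ}
    (hm : ∀ S : Finset ι, S.Nonempty → m S ^ n ∈ Ideal.span (Set.range a))
    (hex : ∀ z : Finset ι →₀ R, z ∅ ∈ J → boundary c z = 0 → ∃ w, w ∅ = 0 ∧ boundary c w = z)
    {N : Type*} [AddCommGroup N] [Module R N] (f : (Finset ι →₀ R) →ₗ[R] N)
    (hf : ∀ z, f (boundary c z) = 0) {k : ℕ} (hk : Fintype.card κ < k) :
    ∃ t : ℕ, ∃ g : Finset ι → N, ∀ S : Finset ι, S.card = k →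
      m S ^ t • f (Finsupp.single S 1) = coboundary (fun S i => c S i ^ (t + 1)) g S := by
  obtain ⟨t, φ, hφ0, hφ1, hφ2⟩ := exists_map_to_koszul a hc hcm hm0 hm
  let Q : Submodule R (Finset ι →₀ R) := Submodule.comap (Finsupp.lapply ∅) J
  let Q' : Submodule R (Finset ι →₀ R) := LinearMap.ker (Finsupp.lapply ∅)
  have hQ' : Q' ≤ Q := fun z hz => by
    have : z ∅ = 0 := hz
    change z ∅ ∈ J
    rw [this]; exact J.zero_mem
  obtain ⟨ψ, hψ0, hψ1, hψ2⟩ := exists_filler (boundary c) (weightsCommute_const a)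
    (fun _ : Finset κ => (0 : Finset ι →₀ R)) 1 (Finsupp.single ∅ 1) (Q := Q) (Q' := Q') hex
    (by rw [boundary_single_one, coboundary_empty]) (by simp [coboundary]) (by
      intro S _ φ _ _
      rw [zero_add, one_smul]
      refine Submodule.sum_mem _ fun i _ => ?_
      change ((eraseSign R S i * a i) • φ (S.erase i)) ∅ ∈ J
      rw [Finsupp.smul_apply, smul_eq_mul]
      exact J.mul_mem_right _ (J.mul_mem_left _ (ha i)))
  simp only [zero_add, one_smul] at hψ2
  let Ψ := Finsupp.linearCombination R ψ
  have hcob : ∀ S : Finset ι, boundary c (m S ^ t • Finsupp.single S 1) =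
      coboundary (fun S i => c S i ^ (t + 1)) (fun S => m S ^ t • Finsupp.single S (1 : R)) S := by
    intro S
    rw [map_smul, boundary_single_one]
    simp only [coboundary, Finset.smul_sum, smul_smul]
    refine Finset.sum_congr rfl fun i hi => ?_
    rw [← hcm S i hi]
    congr 1
    ring
  have hθ : ∀ S : Finset ι, S.Nonempty → m S ^ t • Finsupp.single S 1 - Ψ (φ S) ∈ Q' := by
    intro S hS
    refine sub_mem (Submodule.smul_mem _ _ ?_) ?_
    · change (Finsupp.single S (1 : R)) ∅ = 0
      rw [Finsupp.single_eq_of_ne hS.ne_empty.symm]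
    · refine map_mem_of_mem_chainsOfCard (fun U hU => ?_) (hφ1 S)
      rw [Finsupp.linearCombination_single, one_smul]
      refine hψ1 U (Finset.card_pos.1 ?_)
      rw [hU]
      exact Finset.card_pos.2 hS
  obtain ⟨H, hH0, hH1, hH2⟩ := exists_filler (boundary c) (hc.pow (t + 1))
    (fun S => m S ^ t • Finsupp.single S (1 : R) - Ψ (φ S)) (-1) 0 (Q := Q) (Q' := Q') hex
    (by simp [hm0, hφ0, hψ0, Ψ]) (by
      intro S _
      rw [map_sub, hcob, boundary_linearCombination _ hψ2, hφ2, map_coboundary]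
      simp only [coboundary, smul_sub, Finset.sum_sub_distrib, neg_smul, one_smul, Ψ]
      abel) (by
      intro S hS φ' h0 h1
      refine hQ' (add_mem (hθ S hS) (Submodule.smul_mem _ _ (coboundary_mem_of_forall _ ?_)))
      intro i _
      rcases (S.erase i).eq_empty_or_nonempty with h | h
      · rw [h, h0]; exact zero_mem _
      · exact h1 _ h)
  refine ⟨t, fun S => f (H S), fun S hS => ?_⟩
  have h := congrArg f (hH2 S)
  have hφS : φ S = 0 := by
    ext U
    by_contra hU
    have : U.card = S.card := (Finsupp.mem_supported _ _).1 (hφ1 S) (Finsupp.mem_support_iff.2 hU)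
    have := Finset.card_le_univ U
    lia
  rw [hf, hφS, map_zero, sub_zero, map_add, map_smul, map_smul, map_coboundary, neg_one_smul] at h
  exact eq_of_sub_eq_zero (by rw [sub_eq_add_neg]; exact h.symm)

end Lifting

section Taylor

variable {ι : Type*} [LinearOrder ι] {σ : Type*} [DecidableEq σ]

variable {K}

/-- The exponent of the least common multiple of the squarefree monomials with supports `A i`,
`i ∈ S`. -/
noncomputable def lcmExp (A : ι → Finset σ) (S : Finset ι) : σ →₀ ℕ :=
  ∑ x ∈ S.biUnion A, Finsupp.single x 1

omit [LinearOrder ι] in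
lemma lcmExp_apply (A : ι → Finset σ) (S : Finset ι) (x : σ) :
    lcmExp A S x = if x ∈ S.biUnion A then 1 else 0 := by
  simp [lcmExp, Finsupp.single_apply, Finsupp.finsetSum_apply]

omit [LinearOrder ι] in
lemma lcmExp_le_iff (A : ι → Finset σ) (S : Finset ι) (w : σ →₀ ℕ) :
    lcmExp A S ≤ w ↔ ∀ i ∈ S, ∀ x ∈ A i, 1 ≤ w x := by
  simp only [Finsupp.le_def, lcmExp_apply, Finset.mem_biUnion]
  refine ⟨fun h i hi x hx => ?_, fun h x => ?_⟩
  · have := h x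
    rwa [if_pos ⟨i, hi, hx⟩] at this
  · split_ifs with hx
    · obtain ⟨i, hi, hx⟩ := hx
      exact h i hi x hx
    · exact Nat.zero_le _

variable (K) in
/-- The least common multiple of the squarefree monomials with supports `A i`, `i ∈ S`. -/
noncomputable def lcmMon (A : ι → Finset σ) (S : Finset ι) : MvPolynomial σ K :=
  monomial (lcmExp A S) 1

variable (K) in
/-- The weights of the Taylor complex. -/
noncomputable def taylorWeight (A : ι → Finset σ) (S : Finset ι) (i : ι) : MvPolynomial σ K :=
  monomial (lcmExp A S - lcmExp A (S.erase i)) 1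

lemma lcmExp_erase_le (A : ι → Finset σ) (S : Finset ι) (i : ι) :
    lcmExp A (S.erase i) ≤ lcmExp A S := by
  rw [lcmExp_le_iff]
  intro j hj
  exact (lcmExp_le_iff A S _).1 le_rfl j (Finset.mem_of_mem_erase hj)

lemma taylorWeight_mul_lcmMon (A : ι → Finset σ) (S : Finset ι) (i : ι) :
    taylorWeight K A S i * lcmMon K A (S.erase i) = lcmMon K A S := by
  rw [taylorWeight, lcmMon, lcmMon, monomial_mul, one_mul,
    tsub_add_cancel_of_le (lcmExp_erase_le A S i)]

lemma weightsCommute_taylorWeight (A : ι → Finset σ) : WeightsCommute (taylorWeight K A) := by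
  intro S i _ j _ _
  simp only [taylorWeight, monomial_mul]
  rw [tsub_add_tsub_cancel (lcmExp_erase_le A S i) (lcmExp_erase_le A _ j),
    tsub_add_tsub_cancel (lcmExp_erase_le A S j) (lcmExp_erase_le A _ i),
    Finset.erase_right_comm]

lemma eraseSign_eq_or {R : Type*} [CommRing R] (S : Finset ι) (i : ι) :
    eraseSign R S i = 1 ∨ eraseSign R S i = -1 :=
  neg_one_pow_eq_or R _

lemma map_eraseSign_mul {R : Type*} [CommRing R] (P : R →+ R) (S : Finset ι) (i : ι) (p : R) :
    P (eraseSign R S i * p) = eraseSign R S i * P p := by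
  rcases eraseSign_eq_or (R := R) S i with h | h <;> simp [h]

/-- Extraction of the terms whose exponent satisfies `q`. -/
noncomputable def filterTerms (q : (σ →₀ ℕ) → Prop) [DecidablePred q] :
    MvPolynomial σ K →ₗ[K] MvPolynomial σ K :=
  (basisMonomials σ K).constr K fun w => if q w then monomial w 1 else 0

omit [DecidableEq σ] in
lemma coeff_filterTerms (q : (σ →₀ ℕ) → Prop) [DecidablePred q] (p : MvPolynomial σ K)
    (w : σ →₀ ℕ) : coeff w (filterTerms q p) = if q w then coeff w p else 0 := by
  classical
  induction p using MvPolynomial.induction_on' with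
  | add p p' hp hp' => rw [map_add, coeff_add, hp, hp', coeff_add]; split_ifs <;> simp
  | monomial u r =>
    have h : filterTerms q (monomial u r) = r • if q u then monomial u (1 : K) else 0 := by
      have h1 : (monomial u r : MvPolynomial σ K) = r • basisMonomials σ K u := by
        rw [coe_basisMonomials, smul_monomial, smul_eq_mul, mul_one]
      rw [h1, map_smul, filterTerms, Module.Basis.constr_basis]
    rw [h, coeff_smul, coeff_monomial]
    by_cases huw : u = w
    · subst huw
      rw [if_pos rfl]
      split_ifs <;> simp
    · split_ifs <;> simp [coeff_monomial, huw]

/-- The natural map from the Taylor complex to the simplicial chain complex. -/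
noncomputable def taylorInclusion (A : ι → Finset σ) :
    (Finset ι →₀ MvPolynomial σ K) →ₗ[MvPolynomial σ K] (Finset ι →₀ MvPolynomial σ K) :=
  Finsupp.linearCombination _ fun S => lcmMon K A S • Finsupp.single S 1

omit [LinearOrder ι] in
lemma taylorInclusion_apply (A : ι → Finset σ) (z : Finset ι →₀ MvPolynomial σ K)
    (S : Finset ι) : taylorInclusion A z S = lcmMon K A S * z S := by
  classical
  have : (Finsupp.lapply S).comp (taylorInclusion A) =
      lcmMon K A S • (Finsupp.lapply S : (Finset ι →₀ MvPolynomial σ K) →ₗ[_] _) := by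
    refine Finsupp.lhom_ext' fun U => LinearMap.ext_ring ?_
    by_cases h : U = S
    · subst h; simp [taylorInclusion]
    · simp [taylorInclusion, h]
  exact LinearMap.congr_fun this z

lemma boundary_taylorInclusion (A : ι → Finset σ) (z : Finset ι →₀ MvPolynomial σ K) :
    boundary (fun _ _ => 1) (taylorInclusion A z) =
      taylorInclusion A (boundary (taylorWeight K A) z) := by
  refine boundary_linearCombination _ (fun S => ?_) z
  rw [map_smul, boundary_single_one]
  simp only [coboundary, Finset.smul_sum, smul_smul]
  refine Finset.sum_congr rfl fun i _ => ?_
  rw [← taylorWeight_mul_lcmMon A S i]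
  congr 1
  ring

lemma coneMap_apply {R : Type*} [CommRing R] (v : ι) (y : Finset ι →₀ R) (S : Finset ι) :
    coneMap R v y S = if v ∈ S then eraseSign R S v * y (S.erase v) else 0 := by
  have : (Finsupp.lapply S).comp (coneMap R v) =
      if v ∈ S then eraseSign R S v • Finsupp.lapply (S.erase v) else 0 := by
    refine Finsupp.lhom_ext' fun U => LinearMap.ext_ring ?_
    simp only [LinearMap.comp_apply, Finsupp.lsingle_apply, coneMap_single, Finsupp.lapply_apply]
    by_cases hU : v ∈ U
    · rw [if_pos hU]
      split_ifs with hS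
      · have : U ≠ S.erase v := fun h => by simp [h] at hU
        simp [this]
      · simp
    · rw [if_neg hU]
      split_ifs with hS
      · by_cases h : insert v U = S
        · subst h
          simp [Finset.erase_insert hU, ← eraseSign_erase_of_le (S := insert v U) (le_refl v)]
        · have h' : U ≠ S.erase v := by
            rintro rfl
            exact h (Finset.insert_erase hS)
          simp [h, h']
      · have : insert v U ≠ S := by
          rintro rfl
          exact hS (Finset.mem_insert_self _ _)
        simp [this]
  have h := LinearMap.congr_fun this y
  split_ifs at h ⊢ <;> simpa using h

lemma boundary_mapRange {R : Type*} [CommRing R] (P : R →+ R) (y : Finset ι →₀ R) :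
    boundary (fun _ _ => 1) (Finsupp.mapRange.addMonoidHom P y) =
      Finsupp.mapRange.addMonoidHom P (boundary (fun _ _ => 1) y) := by
  induction y using Finsupp.induction_linear with
  | zero => simp
  | add x y hx hy => simp only [map_add, hx, hy]
  | single S r =>
    have h : ∀ r : R, boundary (fun _ _ => 1) (Finsupp.single S r) =
        ∑ i ∈ S, Finsupp.single (S.erase i) (eraseSign R S i * r) := by
      intro r
      rw [← mul_one r, ← smul_eq_mul, ← Finsupp.smul_single, map_smul, boundary_single_one,
        coboundary, Finset.smul_sum]
      refine Finset.sum_congr rfl fun i _ => ?_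
      simp [mul_comm]
    rw [h, map_sum]
    simp only [Finsupp.mapRange.addMonoidHom_apply, Finsupp.mapRange_single, h, map_eraseSign_mul]

/-- The Taylor complex is exact. -/
lemma exists_boundary_taylorWeight_eq [Finite ι] (A : ι → Finset σ)
    {z : Finset ι →₀ MvPolynomial σ K}
    (hz : z ∅ ∈ Ideal.span (Set.range fun i => lcmMon K A {i}))
    (hdz : boundary (taylorWeight K A) z = 0) :
    ∃ w : Finset ι →₀ MvPolynomial σ K, w ∅ = 0 ∧ boundary (taylorWeight K A) w = z := by
  classical
  have := Fintype.ofFinite ι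
  let v : (σ →₀ ℕ) → Option ι := fun w =>
    if h : ∃ i, lcmExp A {i} ≤ w then some h.choose else none
  have hv : ∀ w i, v w = some i → lcmExp A {i} ≤ w := by
    intro w i h
    by_cases hw : ∃ i, lcmExp A {i} ≤ w
    · simp only [v, dif_pos hw, Option.some.injEq] at h
      exact h ▸ hw.choose_spec
    · simp [v, dif_neg hw] at h
  have hv' : ∀ w i, lcmExp A {i} ≤ w → ∃ j, v w = some j := fun w i h =>
    ⟨_, dif_pos ⟨i, h⟩⟩
  set y := taylorInclusion A z with hy
  have hydvd : ∀ S w, coeff w (y S) ≠ 0 → lcmExp A S ≤ w := by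
    intro S w h
    rw [hy, taylorInclusion_apply, lcmMon, coeff_monomial_mul'] at h
    by_contra hw
    exact h (if_neg hw)
  have hysupp : ∀ S w, coeff w (y S) ≠ 0 → ∃ j, v w = some j := by
    intro S w h
    rcases S.eq_empty_or_nonempty with rfl | ⟨i, hi⟩
    · have hyz : y ∅ = z ∅ := by
        rw [hy, taylorInclusion_apply, lcmMon]
        simp [lcmExp]
      rw [hyz] at h
      have hrange : (Set.range fun i => lcmMon K A {i}) =
          (fun s => monomial s (1 : K)) '' Set.range fun i => lcmExp A {i} := by
        rw [← Set.range_comp]; rfl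
      rw [hrange, mem_ideal_span_monomial_image] at hz
      obtain ⟨_, ⟨i, rfl⟩, hi⟩ := hz w (mem_support_iff.2 h)
      exact hv' w i hi
    · refine hv' w i (le_trans ?_ (hydvd S w h))
      rw [lcmExp_le_iff]
      intro j hj
      rw [Finset.mem_singleton.1 hj]
      exact (lcmExp_le_iff A S _).1 le_rfl i hi
  let P : ι → MvPolynomial σ K →+ MvPolynomial σ K := fun i =>
    (filterTerms fun w => v w = some i).toAddMonoidHom
  have hP : ∀ i p w, coeff w (P i p) = if v w = some i then coeff w p else 0 := fun i p w =>
    coeff_filterTerms _ p w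
  set W := ∑ i, coneMap (MvPolynomial σ K) i (Finsupp.mapRange.addMonoidHom (P i) y) with hW
  have hdy : boundary (fun _ _ => 1) y = 0 := by
    rw [hy, boundary_taylorInclusion, hdz, map_zero]
  have hdW : boundary (fun _ _ => 1) W = y := by
    rw [hW, map_sum]
    have h : ∀ i, boundary (fun _ _ => 1) (coneMap _ i (Finsupp.mapRange.addMonoidHom (P i) y)) =
        Finsupp.mapRange.addMonoidHom (P i) y := by
      intro i
      have h1 := boundary_coneMap_add (fun _ : ι => (1 : MvPolynomial σ K)) i
        (Finsupp.mapRange.addMonoidHom (P i) y)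
      rwa [boundary_mapRange, hdy, map_zero, map_zero, add_zero, one_smul] at h1
    rw [Finset.sum_congr rfl fun i _ => h i]
    ext S w
    rw [Finsupp.finsetSum_apply, coeff_sum]
    simp only [Finsupp.mapRange.addMonoidHom_apply, Finsupp.mapRange_apply, hP]
    by_cases h0 : coeff w (y S) = 0
    · simp [h0]
    · obtain ⟨j, hj⟩ := hysupp S w h0
      simp [hj]
  have hWdvd : ∀ S w, coeff w (W S) ≠ 0 → lcmExp A S ≤ w := by
    intro S w h
    rw [hW, Finsupp.finsetSum_apply, coeff_sum] at h
    obtain ⟨i, -, hi⟩ := Finset.exists_ne_zero_of_sum_ne_zero h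
    rw [coneMap_apply] at hi
    split_ifs at hi with hiS
    · have h2 : coeff w (P i (y (S.erase i))) ≠ 0 := by
        rcases eraseSign_eq_or (R := MvPolynomial σ K) S i with hs | hs <;>
          simpa [hs] using hi
      rw [hP] at h2
      have h3 : v w = some i := by
        by_contra h; exact h2 (if_neg h)
      rw [if_pos h3] at h2
      have h4 := hydvd _ _ h2
      have h5 := hv w i h3
      rw [lcmExp_le_iff] at h4 h5 ⊢
      intro j hj
      by_cases hji : j = i
      · exact h5 j (by simp [hji])
      · exact h4 j (Finset.mem_erase.2 ⟨hji, hj⟩)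
    · simp at hi
  have hW0 : W ∅ = 0 := by
    rw [hW, Finsupp.finsetSum_apply]
    exact Finset.sum_eq_zero fun i _ => by rw [coneMap_apply, if_neg (by simp)]
  let u : Finset ι →₀ MvPolynomial σ K :=
    Finsupp.equivFunOnFinite.symm fun S => (W S).divMonomial (lcmExp A S)
  have hu : taylorInclusion A u = W := by
    ext S w
    rw [taylorInclusion_apply, lcmMon, coeff_monomial_mul']
    split_ifs with h
    · simp [u, coeff_divMonomial, add_tsub_cancel_of_le h]
    · by_contra h2
      exact h (hWdvd S w (Ne.symm h2))
  refine ⟨u, by simp [u, hW0], ?_⟩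
  have h := boundary_taylorInclusion A u
  rw [hu, hdW] at h
  ext1 S
  have h2 := DFunLike.congr_fun h S
  rw [hy, taylorInclusion_apply, taylorInclusion_apply] at h2
  refine (mul_left_cancel₀ ?_ h2).symm
  rw [lcmMon, Ne, monomial_eq_zero]
  exact one_ne_zero

omit [LinearOrder ι] [DecidableEq σ] in
lemma monomial_pow_mul_divMonomial {e a : σ →₀ ℕ} (hea : ∀ x, e x = 0 ∨ (e x = 1 ∧ a x = 0))
    (t : ℕ) (p : MvPolynomial σ K) :
    (monomial e 1 ^ (t + 1) * p).divMonomial (t • (a + e)) =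
      monomial e 1 * p.divMonomial (t • a) := by
  ext w
  rw [coeff_divMonomial, monomial_pow, one_pow, coeff_monomial_mul', coeff_monomial_mul',
    coeff_divMonomial]
  have hiff : (t + 1) • e ≤ t • (a + e) + w ↔ e ≤ w := by
    simp only [Finsupp.le_def, Finsupp.smul_apply, Finsupp.add_apply, smul_eq_mul]
    refine forall_congr' fun x => ?_
    rcases hea x with h | ⟨h, h'⟩
    · simp [h]
    · simp only [h, h']; lia
  by_cases h : e ≤ w
  · rw [if_pos h, if_pos (hiff.2 h)]
    congr 2
    ext x
    have := h x
    simp only [Finsupp.smul_apply, Finsupp.add_apply, Finsupp.tsub_apply, smul_eq_mul]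
    rw [Nat.add_mul, Nat.mul_add]
    lia
  · rw [if_neg h, if_neg (mt hiff.1 h)]

/-- Cochains of the Taylor complex with free coefficients that become coboundaries on a power of
the complex are coboundaries. -/
lemma exists_eq_coboundary_taylorWeight (A : ι → Finset σ) {B : Type*} {t : ℕ}
    (f g : Finset ι → (B →₀ MvPolynomial σ K)) :
    ∃ g' : Finset ι → (B →₀ MvPolynomial σ K), ∀ S,
      lcmMon K A S ^ t • f S = coboundary (fun S i => taylorWeight K A S i ^ (t + 1)) g S →
      f S = coboundary (taylorWeight K A) g' S := by
  let d : Finset ι → MvPolynomial σ K →+ MvPolynomial σ K := fun S =>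
    AddMonoidHom.mk' (fun p => p.divMonomial (t • lcmExp A S)) fun p q => add_divMonomial p q _
  let ρ : Finset ι → (B →₀ MvPolynomial σ K) →+ (B →₀ MvPolynomial σ K) := fun S =>
    Finsupp.mapRange.addMonoidHom (d S)
  refine ⟨fun S => ρ S (g S), fun S hS => ?_⟩
  have h := congrArg (ρ S) hS
  have h1 : ρ S (lcmMon K A S ^ t • f S) = f S := by
    ext1 b
    simp only [ρ, d, Finsupp.mapRange.addMonoidHom_apply, Finsupp.mapRange_apply,
      Finsupp.smul_apply, smul_eq_mul, AddMonoidHom.mk'_apply, lcmMon, monomial_pow, one_pow]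
    exact divMonomial_monomial_mul _ _
  rw [h1, coboundary, map_sum] at h
  rw [h, coboundary]
  refine Finset.sum_congr rfl fun i hi => ?_
  ext1 b
  simp only [ρ, Finsupp.mapRange.addMonoidHom_apply, Finsupp.mapRange_apply,
      Finsupp.smul_apply, smul_eq_mul, mul_assoc]
  rw [map_eraseSign_mul]
  congr 1
  have h2 := monomial_pow_mul_divMonomial (K := K) (e := lcmExp A S - lcmExp A (S.erase i))
    (a := lcmExp A (S.erase i)) (fun x => by
      have := lcmExp_erase_le A S i x
      simp only [Finsupp.tsub_apply, lcmExp_apply] at this ⊢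
      split_ifs at this ⊢ <;> simp_all) t (g (S.erase i) b)
  rw [add_tsub_cancel_of_le (lcmExp_erase_le A S i)] at h2
  exact h2

end Taylor

section ProjectiveDimension

lemma subsingleton_ext_of_hasProjectiveDimensionLT {R : Type u} [CommRing R] (X Y : ModuleCat.{u} R)
    (k : ℕ) [HasProjectiveDimensionLT X (k + 1)] :
    Subsingleton (((Ext R (ModuleCat.{u} R) (k + 1)).obj (Opposite.op X)).obj Y) := by
  let P := ProjectiveResolution.of X
  have hex : (P.complex.linearYonedaObj R Y).ExactAt (k + 1) := by
    rw [HomologicalComplex.exactAt_iff' _ k (k + 1) (k + 2) (by simp) (by simp),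
      ShortComplex.moduleCat_exact_iff]
    intro (f : P.complex.X (k + 1) ⟶ Y) hf
    obtain ⟨g, hg⟩ := (P.extMk_eq_zero_iff f (k + 2) rfl hf k rfl).1
      (Abelian.Ext.eq_zero_of_hasProjectiveDimensionLT _ (k + 1) le_rfl)
    exact ⟨g, hg⟩
  exact ModuleCat.subsingleton_of_isZero (((HomologicalComplex.exactAt_iff_isZero_homology _ _).1
    hex).of_iso (P.isoExt (k + 1) Y))

lemma pdim_le_of_hasProjectiveDimensionLT {R : Type u} [CommRing R] (X : ModuleCat.{u} R) (r : ℕ)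
    [HasProjectiveDimensionLT X (r + 1)] : pdim R X ≤ r := by
  refine sInf_le fun k hk N => ?_
  obtain ⟨l, rfl⟩ := Nat.exists_eq_add_of_lt (Nat.cast_lt.1 hk)
  have := hasProjectiveDimensionLT_of_ge X (r + 1) (r + l + 1) (by lia)
  exact subsingleton_ext_of_hasProjectiveDimensionLT X N (r + l)

lemma hasProjectiveDimensionLT_of_exact {R : Type u} [CommRing R] {L P M : Type u}
    [AddCommGroup L] [Module R L] [AddCommGroup P] [Module R P] [AddCommGroup M] [Module R M]
    [Module.Projective R P] (f : L →ₗ[R] P) (g : P →ₗ[R] M) (hf : Function.Injective f)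
    (hg : Function.Surjective g) (hfg : Function.Exact f g) (n : ℕ)
    [HasProjectiveDimensionLT (ModuleCat.of R L) (n + 1)] :
    HasProjectiveDimensionLT (ModuleCat.of R M) (n + 2) := by
  let S : ShortComplex (ModuleCat.{u} R) :=
    ShortComplex.mk (ModuleCat.ofHom f) (ModuleCat.ofHom g)
      (by ext x; exact hfg.apply_apply_eq_zero x)
  have hS : S.ShortExact := {
    exact := (ShortComplex.ShortExact.moduleCat_exact_iff_function_exact S).2 hfg
    mono_f := (ModuleCat.mono_iff_injective _).2 hf
    epi_g := (ModuleCat.epi_iff_surjective _).2 hg }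
  have hP : Projective S.X₂ := inferInstanceAs (Projective (ModuleCat.of R P))
  exact hS.hasProjectiveDimensionLT_X₃ (n + 1) ‹_› inferInstance

end ProjectiveDimension

section CardProj

variable {ι : Type*} [LinearOrder ι] {R : Type*} [CommRing R]

/-- Projection of the chains onto the part of degree `k`. -/
noncomputable def cardProj (R : Type*) [CommRing R] (ι : Type*) (k : ℕ) :
    (Finset ι →₀ R) →ₗ[R] (Finset ι →₀ R) :=
  Finsupp.linearCombination R fun S => if S.card = k then Finsupp.single S 1 else 0

omit [LinearOrder ι] in
lemma cardProj_single (k : ℕ) (S : Finset ι) :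
    cardProj R ι k (Finsupp.single S 1) = if S.card = k then Finsupp.single S 1 else 0 := by
  rw [cardProj, Finsupp.linearCombination_single, one_smul]

omit [LinearOrder ι] in
lemma cardProj_mem (k : ℕ) (y : Finset ι →₀ R) : cardProj R ι k y ∈ chainsOfCard R ι k := by
  rw [cardProj, Finsupp.linearCombination_apply]
  refine Submodule.sum_mem _ fun S _ => Submodule.smul_mem _ _ ?_
  split_ifs with h
  · exact single_mem_chainsOfCard h 1
  · exact zero_mem _

omit [LinearOrder ι] in
lemma eq_on_chainsOfCard {N : Type*} [AddCommGroup N] [Module R N] {f g : (Finset ι →₀ R) →ₗ[R] N}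
    {k : ℕ} (h : ∀ S : Finset ι, S.card = k → f (Finsupp.single S 1) = g (Finsupp.single S 1))
    {y : Finset ι →₀ R} (hy : y ∈ chainsOfCard R ι k) : f y = g y := by
  have : (f - g) y ∈ (⊥ : Submodule R N) := map_mem_of_mem_chainsOfCard (fun S hS => by
    rw [Submodule.mem_bot, LinearMap.sub_apply, h S hS, sub_self]) hy
  rwa [Submodule.mem_bot, LinearMap.sub_apply, sub_eq_zero] at this

omit [LinearOrder ι] in
lemma cardProj_of_mem {k : ℕ} {y : Finset ι →₀ R} (hy : y ∈ chainsOfCard R ι k) :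
    cardProj R ι k y = y :=
  eq_on_chainsOfCard (g := LinearMap.id) (fun S hS => by
    rw [cardProj_single, if_pos hS, LinearMap.id_apply]) hy

lemma boundary_cardProj (c : Finset ι → ι → R) (k : ℕ) (y : Finset ι →₀ R) :
    boundary c (cardProj R ι (k + 1) y) = cardProj R ι k (boundary c y) := by
  have : (boundary c).comp (cardProj R ι (k + 1)) = (cardProj R ι k).comp (boundary c) := by
    refine Finsupp.lhom_ext' fun S => LinearMap.ext_ring ?_
    simp only [LinearMap.comp_apply, Finsupp.lsingle_apply, cardProj_single, boundary_single_one,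
      map_coboundary]
    have hcard : ∀ i ∈ S, ((S.erase i).card = k ↔ S.card = k + 1) := by
      intro i hi
      rw [Finset.card_erase_of_mem hi]
      have := Finset.card_pos.2 ⟨i, hi⟩
      lia
    split_ifs with h
    · rw [boundary_single_one]
      exact coboundary_congr fun i hi => by rw [if_pos ((hcard i hi).2 h)]
    · rw [map_zero, coboundary]
      exact (Finset.sum_eq_zero fun i hi => by
        rw [if_neg (mt (hcard i hi).1 h), smul_zero]).symm
  exact LinearMap.congr_fun this y

omit [LinearOrder ι] in
lemma apply_empty_of_mem_chainsOfCard {k : ℕ} {y : Finset ι →₀ R}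
    (hy : y ∈ chainsOfCard R ι (k + 1)) : y ∅ = 0 := by
  by_contra h
  have := (Finsupp.mem_supported _ _).1 hy (Finsupp.mem_support_iff.2 h)
  simp at this

instance (k : ℕ) : Module.Projective R (chainsOfCard R ι k) :=
  Module.Projective.of_equiv (Finsupp.supportedEquivFinsupp {S : Finset ι | S.card = k}).symm

end CardProj

section Lyubeznik

variable {ι : Type} [LinearOrder ι] [Finite ι] {σ : Type} [DecidableEq σ]

variable {K}

omit [LinearOrder ι] [Finite ι] in
lemma lcmMon_empty (A : ι → Finset σ) : lcmMon K A ∅ = 1 := by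
  simp [lcmMon, lcmExp]

/-- Above the number of elements of a family that generates `J` up to radical, cocycles on the
Taylor resolution of `J` with free coefficients are coboundaries. -/
lemma exists_eq_comp_boundary_of_free (A : ι → Finset σ) {κ : Type} [LinearOrder κ] [Fintype κ]
    (a : κ → MvPolynomial σ K) (ha : ∀ j, a j ∈ Ideal.span (Set.range fun i => lcmMon K A {i}))
    {n : ℕ} (hm : ∀ S : Finset ι, S.Nonempty → lcmMon K A S ^ n ∈ Ideal.span (Set.range a))
    {k : ℕ} (hk : Fintype.card κ < k) {B : Type*}
    (f : (Finset ι →₀ MvPolynomial σ K) →ₗ[MvPolynomial σ K] (B →₀ MvPolynomial σ K))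
    (hf : ∀ z, f (boundary (taylorWeight K A) z) = 0) :
    ∃ g : (Finset ι →₀ MvPolynomial σ K) →ₗ[MvPolynomial σ K] (B →₀ MvPolynomial σ K),
      ∀ z ∈ chainsOfCard (MvPolynomial σ K) ι k, f z = g (boundary (taylorWeight K A) z) := by
  obtain ⟨t, g, hg⟩ := exists_pow_smul_eq_coboundary a ha (weightsCommute_taylorWeight A)
    (fun S i _ => taylorWeight_mul_lcmMon A S i) (lcmMon_empty A) hm
    (fun z h0 hz => exists_boundary_taylorWeight_eq A h0 hz) f hf hk
  obtain ⟨g', hg'⟩ := exists_eq_coboundary_taylorWeight A (t := t)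
    (fun S => f (Finsupp.single S 1)) g
  refine ⟨Finsupp.linearCombination _ g', fun z hz => ?_⟩
  refine eq_on_chainsOfCard (g := (Finsupp.linearCombination _ g').comp
    (boundary (taylorWeight K A))) (fun S hS => ?_) hz
  rw [hg' S (hg S hS), LinearMap.comp_apply, boundary_single_one, map_coboundary]
  simp only [Finsupp.linearCombination_single, one_smul]

/-- Above the number of elements of a family that generates `J` up to radical, cocycles on the
Taylor resolution of `J` are coboundaries. -/
lemma exists_eq_comp_boundary (A : ι → Finset σ) {κ : Type} [LinearOrder κ] [Fintype κ]
    (a : κ → MvPolynomial σ K) (ha : ∀ j, a j ∈ Ideal.span (Set.range fun i => lcmMon K A {i}))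
    {n : ℕ} (hm : ∀ S : Finset ι, S.Nonempty → lcmMon K A S ^ n ∈ Ideal.span (Set.range a))
    (l : ℕ) : ∀ (k : ℕ), Nat.card ι < k + l → Fintype.card κ < k →
    ∀ (N : Type u) [AddCommGroup N] [Module (MvPolynomial σ K) N]
    (f : (Finset ι →₀ MvPolynomial σ K) →ₗ[MvPolynomial σ K] N),
    (∀ z ∈ chainsOfCard (MvPolynomial σ K) ι (k + 1), f (boundary (taylorWeight K A) z) = 0) →
    ∃ g : (Finset ι →₀ MvPolynomial σ K) →ₗ[MvPolynomial σ K] N,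
      ∀ z ∈ chainsOfCard (MvPolynomial σ K) ι k, f z = g (boundary (taylorWeight K A) z) := by
  have := Fintype.ofFinite ι
  induction l with
  | zero =>
    intro k hl hk N _ _ f hf
    refine ⟨0, fun z hz => eq_on_chainsOfCard (g := 0) (fun S hS => ?_) hz⟩
    have := Finset.card_le_univ S
    rw [Nat.card_eq_fintype_card] at hl
    lia
  | succ l ih =>
    intro k hl hk N _ _ f hf
    let R := MvPolynomial σ K
    set d := boundary (taylorWeight K A) with hd
    let ε : (N →₀ R) →ₗ[R] N := Finsupp.linearCombination R id
    let f' : (Finset ι →₀ R) →ₗ[R] (N →₀ R) := Finsupp.linearCombination R fun S =>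
      Finsupp.single (f (Finsupp.single S 1)) 1
    have hf' : ∀ z, ε (f' z) = f z := by
      intro z
      have : ε.comp f' = f := by
        refine Finsupp.lhom_ext' fun S => LinearMap.ext_ring ?_
        simp [ε, f']
      exact LinearMap.congr_fun this z
    let φ : (Finset ι →₀ R) →ₗ[R] LinearMap.ker ε :=
      LinearMap.codRestrict _ (f'.comp (d.comp (cardProj R ι (k + 1)))) fun z => by
        rw [LinearMap.mem_ker, LinearMap.comp_apply, LinearMap.comp_apply, hf']
        exact hf _ (cardProj_mem _ _)
    have hφ : ∀ z ∈ chainsOfCard R ι (k + 1), (φ z : N →₀ R) = f' (d z) := by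
      intro z hz
      change f' (d (cardProj R ι (k + 1) z)) = _
      rw [cardProj_of_mem hz]
    obtain ⟨g', hg'⟩ := ih (k + 1) (by lia) (by lia) (LinearMap.ker ε) φ (fun z hz => by
      refine Subtype.ext ?_
      rw [hφ _ (boundary_mem_chainsOfCard _ hz), hd,
        boundary_boundary (weightsCommute_taylorWeight A), map_zero]
      rfl)
    obtain ⟨h, hh⟩ := exists_eq_comp_boundary_of_free A a ha hm hk
      ((f' - (LinearMap.ker ε).subtype.comp g').comp (cardProj R ι k)) (fun z => by
        have h1 := hg' _ (cardProj_mem (R := R) (k + 1) z)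
        have h2 := hφ _ (cardProj_mem (R := R) (k + 1) z)
        rw [h1] at h2
        rw [LinearMap.comp_apply, ← boundary_cardProj, LinearMap.sub_apply, ← hd, ← h2]
        exact sub_self _)
    refine ⟨ε.comp h, fun z hz => ?_⟩
    rw [LinearMap.comp_apply, ← hh z hz, LinearMap.comp_apply, cardProj_of_mem hz,
      LinearMap.sub_apply, map_sub, hf']
    have : ε ((LinearMap.ker ε).subtype.comp g' z) = 0 := (g' z).2
    rw [this, sub_zero]

variable (K) in
/-- The cycles of degree `k` of the Taylor resolution. -/
noncomputable def taylorCycles (A : ι → Finset σ) (k : ℕ) :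
    Submodule (MvPolynomial σ K) (Finset ι →₀ MvPolynomial σ K) :=
  chainsOfCard _ ι k ⊓ (LinearMap.ker (boundary (taylorWeight K A)) ⊓
    Submodule.comap (Finsupp.lapply ∅) (Ideal.span (Set.range fun i => lcmMon K A {i})))

variable (K) in
/-- The inclusion of the cycles of degree `k` of the Taylor resolution. -/
noncomputable def taylorCyclesInclusion (A : ι → Finset σ) (k : ℕ) :
    taylorCycles K A k →ₗ[MvPolynomial σ K] chainsOfCard (MvPolynomial σ K) ι k :=
  Submodule.inclusion inf_le_left

omit [Finite ι] in
lemma taylorCyclesInclusion_injective (A : ι → Finset σ) (k : ℕ) :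
    Function.Injective (taylorCyclesInclusion K A k) :=
  Submodule.inclusion_injective _

omit [Finite ι] in
lemma boundary_apply_empty_mem (A : ι → Finset σ) (z : Finset ι →₀ MvPolynomial σ K) :
    boundary (taylorWeight K A) z ∅ ∈ Ideal.span (Set.range fun i => lcmMon K A {i}) := by
  rw [boundary, Finsupp.linearCombination_apply, Finsupp.sum, Finsupp.finsetSum_apply]
  refine Submodule.sum_mem _ fun S _ => Submodule.smul_mem _ _ ?_
  rw [coboundary, Finsupp.finsetSum_apply]
  refine Submodule.sum_mem _ fun i hi => ?_
  rw [Finsupp.smul_apply, smul_eq_mul, mul_assoc]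
  refine Ideal.mul_mem_left _ _ ?_
  by_cases h : S.erase i = ∅
  · have hS : S = {i} := by rw [← Finset.insert_erase hi, h]; rfl
    have h1 := taylorWeight_mul_lcmMon (K := K) A S i
    rw [h, lcmMon_empty] at h1
    rw [h, Finsupp.single_eq_same, h1, hS]
    exact Ideal.subset_span ⟨i, rfl⟩
  · rw [Finsupp.single_eq_of_ne (Ne.symm h), mul_zero]
    exact zero_mem _

variable (K) in
/-- The differential of the Taylor resolution onto the cycles. -/
noncomputable def toTaylorCycles (A : ι → Finset σ) (k : ℕ) :
    chainsOfCard (MvPolynomial σ K) ι (k + 1) →ₗ[MvPolynomial σ K] taylorCycles K A k :=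
  LinearMap.codRestrict _ ((boundary (taylorWeight K A)).comp (Submodule.subtype _)) fun z =>
    ⟨boundary_mem_chainsOfCard _ z.2,
      boundary_boundary (weightsCommute_taylorWeight A) _, boundary_apply_empty_mem A _⟩

lemma toTaylorCycles_surjective (A : ι → Finset σ) (k : ℕ) :
    Function.Surjective (toTaylorCycles K A k) := by
  rintro ⟨z, hz, hz', h0⟩
  obtain ⟨w, -, hw⟩ := exists_boundary_taylorWeight_eq A h0 hz'
  refine ⟨⟨cardProj _ ι (k + 1) w, cardProj_mem _ _⟩, Subtype.ext ?_⟩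
  change boundary (taylorWeight K A) (cardProj _ ι (k + 1) w) = z
  rw [boundary_cardProj, hw, cardProj_of_mem hz]

omit [Finite ι] in
lemma exact_toTaylorCycles (A : ι → Finset σ) (k : ℕ) :
    Function.Exact (taylorCyclesInclusion K A (k + 1))
      (toTaylorCycles K A k) := by
  intro z
  have h0 : toTaylorCycles K A k z = 0 ↔ boundary (taylorWeight K A) z = 0 := by
    rw [Subtype.ext_iff]; rfl
  rw [h0]
  refine ⟨fun h => ⟨⟨z, z.2, h, ?_⟩, rfl⟩, ?_⟩
  · change (z : Finset ι →₀ MvPolynomial σ K) ∅ ∈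
      Ideal.span (Set.range fun i => lcmMon K A {i})
    rw [apply_empty_of_mem_chainsOfCard z.2]
    exact zero_mem _
  · rintro ⟨w, rfl⟩
    exact w.2.2.1

variable (K) in
/-- The augmentation of the Taylor resolution. -/
noncomputable def taylorAugmentation (A : ι → Finset σ) :
    chainsOfCard (MvPolynomial σ K) ι 0 →ₗ[MvPolynomial σ K]
      (MvPolynomial σ K ⧸ Ideal.span (Set.range fun i => lcmMon K A {i})) :=
  (Submodule.mkQ _).comp ((Finsupp.lapply ∅).comp (Submodule.subtype _))

omit [LinearOrder ι] [Finite ι] in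
lemma taylorAugmentation_surjective (A : ι → Finset σ) :
    Function.Surjective (taylorAugmentation K A) := by
  intro y
  obtain ⟨r, rfl⟩ := Submodule.mkQ_surjective _ y
  refine ⟨⟨Finsupp.single ∅ r, single_mem_chainsOfCard rfl r⟩, ?_⟩
  simp [taylorAugmentation]

omit [Finite ι] in
lemma exact_taylorAugmentation (A : ι → Finset σ) :
    Function.Exact (taylorCyclesInclusion K A 0)
      (taylorAugmentation K A) := by
  intro z
  have h0 : taylorAugmentation K A z = 0 ↔
      (z : Finset ι →₀ MvPolynomial σ K) ∅ ∈ Ideal.span (Set.range fun i => lcmMon K A {i}) :=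
    Submodule.Quotient.mk_eq_zero _
  rw [h0]
  refine ⟨fun h => ⟨⟨z, z.2, boundary_eq_zero_of_mem_chainsOfCard_zero _ z.2, h⟩, rfl⟩, ?_⟩
  rintro ⟨w, rfl⟩
  exact w.2.2.2

lemma hasProjectiveDimensionLT_of_taylorCycles (A : ι → Finset σ) (k : ℕ) : ∀ (n : ℕ),
    HasProjectiveDimensionLT (ModuleCat.of (MvPolynomial σ K) (taylorCycles K A k)) (n + 1) →
    HasProjectiveDimensionLT (ModuleCat.of (MvPolynomial σ K)
      (MvPolynomial σ K ⧸ Ideal.span (Set.range fun i => lcmMon K A {i}))) (n + k + 2) := by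
  induction k with
  | zero =>
    intro n _
    exact hasProjectiveDimensionLT_of_exact (L := taylorCycles K A 0)
      (P := chainsOfCard (MvPolynomial σ K) ι 0) (taylorCyclesInclusion K A 0)
      (taylorAugmentation K A) (taylorCyclesInclusion_injective A 0)
      (taylorAugmentation_surjective A) (exact_taylorAugmentation A) n
  | succ k ih =>
    intro n _
    have := ih (n + 1) (hasProjectiveDimensionLT_of_exact (L := taylorCycles K A (k + 1))
      (P := chainsOfCard (MvPolynomial σ K) ι (k + 1)) (M := taylorCycles K A k)
      (taylorCyclesInclusion K A (k + 1)) (toTaylorCycles K A k)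
      (taylorCyclesInclusion_injective A (k + 1)) (toTaylorCycles_surjective A k)
      (exact_toTaylorCycles A k) n)
    rwa [show n + (k + 1) + 2 = n + 1 + k + 2 by lia]

lemma projective_of_exact_of_comp_eq_id {R L P M : Type*} [CommRing R]
    [AddCommGroup L] [Module R L] [AddCommGroup P] [Module R P] [AddCommGroup M] [Module R M]
    [Module.Projective R P] (f : L →ₗ[R] P) (g : P →ₗ[R] M)
    (hg : Function.Surjective g) (hfg : Function.Exact f g) {l : P →ₗ[R] L}
    (hl : l.comp f = LinearMap.id) : Module.Projective R M := by
  have h : (Function.Injective f ∧ ∃ s : M →ₗ[R] P, g.comp s = LinearMap.id) ↔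
      (Function.Surjective g ∧ ∃ l : P →ₗ[R] L, l.comp f = LinearMap.id) := hfg.split_tfae'.out 0 1
  obtain ⟨-, s, hs⟩ := h.2 ⟨hg, l, hl⟩
  exact Module.Projective.of_split s g hs

/-- **Lyubeznik's bound**, for families contained in the ideal. -/
lemma hasProjectiveDimensionLT_of_pow_mem (A : ι → Finset σ) {r : ℕ}
    (a : Fin r → MvPolynomial σ K)
    (ha : ∀ j, a j ∈ Ideal.span (Set.range fun i => lcmMon K A {i}))
    {n : ℕ} (hm : ∀ S : Finset ι, S.Nonempty → lcmMon K A S ^ n ∈ Ideal.span (Set.range a)) :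
    HasProjectiveDimensionLT (ModuleCat.of (MvPolynomial σ K)
      (MvPolynomial σ K ⧸ Ideal.span (Set.range fun i => lcmMon K A {i}))) (r + 1) := by
  obtain ⟨g, hg⟩ := exists_eq_comp_boundary A a ha hm (Nat.card ι) (r + 1) (by lia) (by simp)
    (taylorCycles K A r) ((toTaylorCycles K A r).comp
      (LinearMap.codRestrict _ (cardProj _ ι (r + 1)) (cardProj_mem (r + 1)))) (fun z hz => by
        refine Subtype.ext ?_
        change boundary (taylorWeight K A) (cardProj _ ι (r + 1) _) = 0
        rw [cardProj_of_mem (boundary_mem_chainsOfCard _ hz),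
          boundary_boundary (weightsCommute_taylorWeight A)])
  have hretr : (g.comp (Submodule.subtype _)).comp
      (taylorCyclesInclusion K A r) = LinearMap.id := by
    refine LinearMap.ext fun z => ?_
    obtain ⟨w, rfl⟩ := toTaylorCycles_surjective A r z
    change g (boundary (taylorWeight K A) w) = toTaylorCycles K A r w
    rw [← hg w w.2, LinearMap.comp_apply]
    congr 1
    exact Subtype.ext (cardProj_of_mem w.2)
  cases r with
  | zero =>
    have := projective_of_exact_of_comp_eq_id (L := taylorCycles K A 0)
      (P := chainsOfCard (MvPolynomial σ K) ι 0) (taylorCyclesInclusion K A 0)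
      (taylorAugmentation K A) (taylorAugmentation_surjective A) (exact_taylorAugmentation A) hretr
    exact inferInstance
  | succ r =>
    have := projective_of_exact_of_comp_eq_id (L := taylorCycles K A (r + 1))
      (P := chainsOfCard (MvPolynomial σ K) ι (r + 1)) (M := taylorCycles K A r)
      (taylorCyclesInclusion K A (r + 1))
      (toTaylorCycles K A r) (toTaylorCycles_surjective A r) (exact_toTaylorCycles A r) hretr
    have h := hasProjectiveDimensionLT_of_taylorCycles (K := K) A r 0 inferInstance
    rwa [show 0 + r + 2 = r + 1 + 1 by lia] at h

end Lyubeznik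

section ArithmeticalRank

lemma exists_radical_eq_of_fg {R : Type*} [CommRing R] {I : Ideal R} (hI : I.FG) :
    ∃ a : Fin (ara I) → R, (Ideal.span (Set.range a)).radical = I.radical := by
  refine Nat.sInf_mem
    (s := {r : ℕ | ∃ a : Fin r → R, (Ideal.span (Set.range a)).radical = I.radical}) ?_
  obtain ⟨r, a, ha⟩ := Submodule.fg_iff_exists_fin_generating_family.1 hI
  exact ⟨r, a, congrArg Ideal.radical ha⟩

lemma ara_map_le {R S : Type*} [CommRing R] [CommRing S] (f : R →+* S) {I : Ideal R}
    (hI : I.FG) : ara (I.map f) ≤ ara I := by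
  obtain ⟨a, ha⟩ := exists_radical_eq_of_fg hI
  refine Nat.sInf_le ⟨f ∘ a, ?_⟩
  rw [Set.range_comp, ← Ideal.map_span]
  refine le_antisymm (Ideal.radical_le_radical_iff.2 ?_) (Ideal.radical_le_radical_iff.2 ?_)
  · exact (Ideal.map_mono (Ideal.le_radical.trans ha.le)).trans (Ideal.map_radical_le f)
  · exact (Ideal.map_mono (Ideal.le_radical.trans ha.ge)).trans (Ideal.map_radical_le f)

variable {K}

lemma pdim_le_of_radical_eq {ι : Type} [LinearOrder ι] [Finite ι] {σ : Type} [DecidableEq σ]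
    (A : ι → Finset σ) {r : ℕ} (a : Fin r → MvPolynomial σ K)
    (ha : (Ideal.span (Set.range a)).radical =
      (Ideal.span (Set.range fun i => lcmMon K A {i})).radical) :
    pdim (MvPolynomial σ K) (ModuleCat.of (MvPolynomial σ K)
      (MvPolynomial σ K ⧸ Ideal.span (Set.range fun i => lcmMon K A {i}))) ≤ r := by
  have := Fintype.ofFinite ι
  set I := Ideal.span (Set.range fun i => lcmMon K A {i}) with hI
  have hpow : ∀ j, ∃ s : ℕ, a j ^ s ∈ I := fun j =>
    ha.le (Ideal.le_radical (Ideal.subset_span ⟨j, rfl⟩))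
  choose s hs using hpow
  set b : Fin r → MvPolynomial σ K := fun j => a j ^ s j with hb
  have hle : I.radical ≤ (Ideal.span (Set.range b)).radical := by
    rw [← ha, Ideal.radical_le_radical_iff, Ideal.span_le]
    rintro _ ⟨j, rfl⟩
    exact ⟨s j, Ideal.subset_span ⟨j, rfl⟩⟩
  have hgen : ∀ i, ∃ n : ℕ, lcmMon K A {i} ^ n ∈ Ideal.span (Set.range b) := fun i =>
    hle (Ideal.le_radical (Ideal.subset_span ⟨i, rfl⟩))
  choose n hn using hgen
  have := hasProjectiveDimensionLT_of_pow_mem (K := K) A b hs (n := ∑ i, n i) (by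
    rintro S ⟨i, hi⟩
    have hdvd : lcmMon K A {i} ∣ lcmMon K A S := by
      refine (monomial_one_dvd_monomial_one).2 ?_
      rw [lcmExp_le_iff]
      intro j hj x hx
      rw [Finset.mem_singleton.1 hj] at hx
      exact (lcmExp_le_iff A S _).1 le_rfl i hi x hx
    exact Ideal.mem_of_dvd _ ((pow_dvd_pow _ (Finset.single_le_sum (f := n)
      (fun _ _ => Nat.zero_le _) (Finset.mem_univ i))).trans (pow_dvd_pow_of_dvd hdvd _)) (hn i))
  exact pdim_le_of_hasProjectiveDimensionLT _ r

end ArithmeticalRank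

section SquarefreeMonomialIdeals

variable {K}

lemma lcmMon_singleton {ι σ : Type*} [DecidableEq σ] (A : ι → Finset σ) (i : ι) :
    lcmMon K A {i} = ∏ x ∈ A i, X x := by
  rw [lcmMon, lcmExp, Finset.singleton_biUnion, monomial_sum_one]
  rfl

lemma sqfMon_mem_span_iff (𝒜 : Set (Finset ℕ)) (B : Finset ℕ) :
    sqfMon K B ∈ Ideal.span ((fun A => sqfMon K A) '' 𝒜) ↔ ∃ A ∈ 𝒜, A ⊆ B := by
  have h : ∀ A, sqfMon K A = monomial (lcmExp id {A}) 1 := fun A =>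
    (lcmMon_singleton id A).symm
  have hspan : (fun A => sqfMon K A) '' 𝒜 =
      (fun s => monomial s (1 : K)) '' ((fun A => lcmExp id {A}) '' 𝒜) := by
    rw [Set.image_image]
    exact Set.image_congr fun A _ => h A
  classical
  rw [hspan, mem_ideal_span_monomial_image, h, support_monomial, if_neg one_ne_zero]
  simp only [Finset.mem_singleton, forall_eq, Set.exists_mem_image, lcmExp_le_iff, id]
  refine exists_congr fun A => and_congr_right fun _ => forall₂_congr fun x _ => ?_
  simp [lcmExp_apply, Nat.one_le_iff_ne_zero]

lemma sqfMon_dvd_of_subset {A B : Finset ℕ} (h : A ⊆ B) : sqfMon K A ∣ sqfMon K B :=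
  Finset.prod_dvd_prod_of_subset _ _ _ h

lemma exists_subset_mem_minSupp {I : Ideal (MvPolynomial ℕ K)} (A : Finset ℕ)
    (hA : sqfMon K A ∈ I) : ∃ B ∈ minSupp K I, B ⊆ A := by
  induction A using Finset.strongInduction with
  | H A ih =>
    by_cases h : ∀ B : Finset ℕ, B ⊂ A → sqfMon K B ∉ I
    · exact ⟨A, ⟨hA, h⟩, subset_rfl⟩
    · push Not at h
      obtain ⟨B, hBA, hB⟩ := h
      obtain ⟨D, hD, hDB⟩ := ih B hBA hB
      exact ⟨D, hD, hDB.trans hBA.subset⟩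

lemma IsFGSqfMonIdeal.finite_minSupp {I : Ideal (MvPolynomial ℕ K)}
    (hI : IsFGSqfMonIdeal K I) : (minSupp K I).Finite := by
  obtain ⟨𝒜, rfl⟩ := hI
  refine 𝒜.finite_toSet.subset fun A hA => ?_
  obtain ⟨B, hB, hBA⟩ := (sqfMon_mem_span_iff _ A).1 hA.1
  obtain rfl | hlt := hBA.eq_or_ssubset
  · exact hB
  · exact (hA.2 B hlt (Ideal.subset_span ⟨B, hB, rfl⟩)).elim

lemma IsFGSqfMonIdeal.eq_span_minSupp {I : Ideal (MvPolynomial ℕ K)}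
    (hI : IsFGSqfMonIdeal K I) : I = Ideal.span ((fun A => sqfMon K A) '' minSupp K I) := by
  obtain ⟨𝒜, h𝒜⟩ := hI
  refine le_antisymm ?_ ?_
  · conv_lhs => rw [h𝒜]
    rw [Ideal.span_le]
    rintro _ ⟨A, hA, rfl⟩
    obtain ⟨B, hB, hBA⟩ := exists_subset_mem_minSupp (K := K) (I := I) A
      (by rw [h𝒜]; exact Ideal.subset_span ⟨A, hA, rfl⟩)
    exact Ideal.mem_of_dvd _ (sqfMon_dvd_of_subset hBA) (Ideal.subset_span ⟨B, hB, rfl⟩)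
  · rw [Ideal.span_le]
    rintro _ ⟨A, hA, rfl⟩
    exact hA.1

open Classical in
variable (K) in
/-- The squarefree monomial with support `A ∩ V` in the polynomial ring in the variables `V`. -/
noncomputable def sqfMonOn (V : Set ℕ) (A : Finset ℕ) : MvPolynomial V K :=
  ∏ x ∈ A.subtype (· ∈ V), X x

lemma rename_sqfMonOn {V : Set ℕ} {A : Finset ℕ} (h : (A : Set ℕ) ⊆ V) :
    rename Subtype.val (sqfMonOn K V A) = sqfMon K A := by
  classical
  rw [sqfMonOn, sqfMon, map_prod]
  simp only [rename_X]
  exact Finset.prod_subtype_of_mem (fun x => (X x : MvPolynomial ℕ K)) fun x hx => h hx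

lemma subset_varSet {I : Ideal (MvPolynomial ℕ K)} {A : Finset ℕ} (hA : A ∈ minSupp K I) :
    (A : Set ℕ) ⊆ varSet K I :=
  Set.subset_biUnion_of_mem (u := fun A : Finset ℕ => (A : Set ℕ)) hA

lemma IsFGSqfMonIdeal.restrictIdeal_eq_span {I : Ideal (MvPolynomial ℕ K)}
    (hI : IsFGSqfMonIdeal K I) :
    restrictIdeal K I = Ideal.span (sqfMonOn K (varSet K I) '' minSupp K I) := by
  refine le_antisymm (fun p hp => ?_) ?_
  · have hinj : Function.Injective (Subtype.val : varSet K I → ℕ) := Subtype.val_injective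
    have hp' : rename Subtype.val p ∈ Ideal.span ((fun A => sqfMon K A) '' minSupp K I) :=
      hI.eq_span_minSupp.le hp
    have := Ideal.mem_map_of_mem (killCompl (R := K) hinj) hp'
    rw [Ideal.map_span, killCompl_rename_app, Set.image_image] at this
    convert this using 2
    refine Set.image_congr fun A hA => ?_
    rw [← rename_sqfMonOn (subset_varSet hA), killCompl_rename_app]
  · rw [Ideal.span_le]
    rintro _ ⟨A, hA, rfl⟩
    change rename _ _ ∈ I
    rw [rename_sqfMonOn (subset_varSet hA)]
    exact hA.1

lemma IsFGSqfMonIdeal.fg_restrictIdeal {I : Ideal (MvPolynomial ℕ K)}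
    (hI : IsFGSqfMonIdeal K I) : (restrictIdeal K I).FG := by
  rw [hI.restrictIdeal_eq_span]
  exact Submodule.fg_span (hI.finite_minSupp.image _)

/-- **Lyubeznik's inequality**: the projective dimension is at most the arithmetical rank. -/
lemma IsFGSqfMonIdeal.pdRestrict_le_ara {I : Ideal (MvPolynomial ℕ K)}
    (hI : IsFGSqfMonIdeal K I) : pdRestrict K I ≤ (ara (restrictIdeal K I) : ℕ∞) := by
  classical
  have := hI.finite_minSupp.to_subtype
  let e := Finite.equivFin (minSupp K I)
  have hspan : restrictIdeal K I = Ideal.span (Set.range fun i =>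
      lcmMon K (fun i => (e.symm i).1.subtype (· ∈ varSet K I)) {i}) := by
    rw [hI.restrictIdeal_eq_span, Set.image_eq_range, ← e.symm.surjective.range_comp]
    congr 2
    funext i
    rw [lcmMon_singleton, Function.comp_apply, sqfMonOn]
  obtain ⟨a, ha⟩ := exists_radical_eq_of_fg hI.fg_restrictIdeal
  have h := pdim_le_of_radical_eq (K := K) _ a (ha.trans (congrArg Ideal.radical hspan))
  rwa [← hspan] at h

lemma map_restrictIdeal_of_connects {I J : Ideal (MvPolynomial ℕ K)}
    (hI : IsFGSqfMonIdeal K I) (hJ : IsFGSqfMonIdeal K J) (h : Connects K I J) :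
    ∃ φ : MvPolynomial (varSet K I) K →ₐ[K] MvPolynomial (varSet K J) K,
      (restrictIdeal K I).map φ = restrictIdeal K J := by
  classical
  obtain ⟨τ, M, hτ, hdisj, hM, hτM⟩ := h
  let φ : MvPolynomial (varSet K I) K →ₐ[K] MvPolynomial (varSet K J) K :=
    aeval fun x => sqfMonOn K (varSet K J) (M x)
  have hφ : ∀ A ∈ minSupp K I,
      φ (sqfMonOn K (varSet K I) A) = sqfMonOn K (varSet K J) (τ A) := by
    intro A hA
    have hAI := subset_varSet hA
    refine rename_injective _ Subtype.val_injective ?_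
    rw [rename_sqfMonOn (subset_varSet (hτ.mapsTo hA)), hτM A hA, sqfMon,
      Finset.prod_biUnion fun x hx y hy hxy => hdisj x (hAI hx) y (hAI hy) hxy,
      sqfMonOn, map_prod, map_prod]
    simp only [φ, aeval_X]
    rw [← Finset.prod_subtype_of_mem (p := (· ∈ varSet K I)) _ fun x hx => hAI hx]
    refine Finset.prod_congr rfl fun x _ => ?_
    exact rename_sqfMonOn (hM x x.2)
  refine ⟨φ, ?_⟩
  rw [hI.restrictIdeal_eq_span, hJ.restrictIdeal_eq_span, Ideal.map_span, Set.image_image,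
    ← hτ.image_eq, Set.image_image]
  exact congrArg Ideal.span (Set.image_congr hφ)

end SquarefreeMonomialIdeals

/-!
Statement 13 (Proposition `claim:Reduction`): let `𝒜` be a generic set on a
property `C`.  Suppose all ideals in `𝓘(C)` have the same projective
dimension `pd_{K[X(I)]} K[X(I)]/(I ∩ K[X(I)])`, and that
`ara (I ∩ K[X(I)]) = pd_{K[X(I)]} K[X(I)]/(I ∩ K[X(I)])` for all `I ∈ 𝒜`.
Then the same equality holds for all `I ∈ 𝓘(C)`.
-/

theorem ara_eq_pd_of_generic_set
    (C 𝒜 : Set (Ideal (MvPolynomial ℕ K)))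
    (hgen : IsGenericSet K C 𝒜)
    (hpd : ∀ I J : Ideal (MvPolynomial ℕ K),
      IsFGSqfMonIdeal K I → I ∈ C → IsFGSqfMonIdeal K J → J ∈ C →
      pdRestrict K I = pdRestrict K J)
    (hara : ∀ I ∈ 𝒜, (ara (restrictIdeal K I) : ℕ∞) = pdRestrict K I) :
    ∀ I, IsFGSqfMonIdeal K I → I ∈ C →
      (ara (restrictIdeal K I) : ℕ∞) = pdRestrict K I := by
  intro J hJ hJC
  obtain ⟨I, hI, hIJ⟩ := hgen.2 J hJ hJC
  obtain ⟨hIfg, hIC⟩ := hgen.1 I hI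
  refine le_antisymm ?_ hJ.pdRestrict_le_ara
  obtain ⟨φ, hφ⟩ := map_restrictIdeal_of_connects hIfg hJ hIJ
  calc (ara (restrictIdeal K J) : ℕ∞)
      ≤ ara (restrictIdeal K I) := by
        rw [← hφ]
        exact_mod_cast ara_map_le φ.toRingHom hIfg.fg_restrictIdeal
    _ = pdRestrict K I := hara I hI
    _ = pdRestrict K J := hpd I J hIfg hIC hJ hJC
end

section
/- Let K be a field, S = K[x_1,…,x_23], and I = (m_1, m_2, m_3, m_4, m_5) ⊆ S the squarefree monomial ideal with m_1 = x_1x_3x_7x_8x_9x_10x_12x_14x_15x_18x_19x_20x_21x_22, m_2 = x_2x_4x_5x_8x_9x_11x_13x_14x_17x_18x_19x_20x_21x_23, m_3 = x_3x_5x_9x_11x_12x_15x_16x_17x_19x_20x_22x_23, m_4 = x_4x_6x_10x_11x_12x_13x_16x_18x_19x_21x_22x_23, m_5 = x_6x_7x_10x_13x_14x_15x_16x_17x_20x_21x_22x_23. Set f_1 = gcd(m_1, m_3) + gcd(m_4, m_5)·m_2, f_2 = gcd(m_2, m_3) + gcd(m_4, m_5)·m_1, and g_1 = x_16·f_1·f_2,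 g_2 = m_1·f_1 + m_4, g_3 = m_2·f_2 + m_5. Then √((g_1, g_2, g_3)) = √I; in particular ara I ≤ 3. -/
/-!
Statement 16: in `S = K[x_1,…,x_23]` (variables `x_k = X (k-1)` over
`Fin 23`), for the explicit squarefree monomial ideal
`I = (m_1,…,m_5)` below, the three elements
`g_1 = x_16 f_1 f_2`, `g_2 = m_1 f_1 + m_4`, `g_3 = m_2 f_2 + m_5`, where
`f_1 = gcd(m_1,m_3) + gcd(m_4,m_5) m_2` and
`f_2 = gcd(m_2,m_3) + gcd(m_4,m_5) m_1`, generate `I` up to radical: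
`√(g_1,g_2,g_3) = √I`; in particular `ara I ≤ 3`.

The gcd of two squarefree monomials is the monomial whose support is the
intersection of their supports.
-/

open MvPolynomial

universe u

variable (K : Type u) [Field K]

/-- The squarefree monomial with support `A`. -/
noncomputable def mon (A : Finset (Fin 23)) : MvPolynomial (Fin 23) K :=
  ∏ v ∈ A, X v

/-- The support of `m_1`. -/
def A1 : Finset (Fin 23) := {0, 2, 6, 7, 8, 9, 11, 13, 14, 17, 18, 19, 20, 21}

/-- The support of `m_2`. -/
def A2 : Finset (Fin 23) := {1, 3, 4, 7, 8, 10, 12, 13, 16, 17, 18, 19, 20, 22}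

/-- The support of `m_3`. -/
def A3 : Finset (Fin 23) := {2, 4, 8, 10, 11, 14, 15, 16, 18, 19, 21, 22}

/-- The support of `m_4`. -/
def A4 : Finset (Fin 23) := {3, 5, 9, 10, 11, 12, 15, 17, 18, 20, 21, 22}

/-- The support of `m_5`. -/
def A5 : Finset (Fin 23) := {5, 6, 9, 12, 13, 14, 15, 16, 19, 20, 21, 22}

noncomputable def m1 : MvPolynomial (Fin 23) K := mon K A1
noncomputable def m2 : MvPolynomial (Fin 23) K := mon K A2
noncomputable def m3 : MvPolynomial (Fin 23) K := mon K A3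
noncomputable def m4 : MvPolynomial (Fin 23) K := mon K A4
noncomputable def m5 : MvPolynomial (Fin 23) K := mon K A5

/-- `f_1 = gcd(m_1, m_3) + gcd(m_4, m_5) ⬝ m_2`. -/
noncomputable def f1 : MvPolynomial (Fin 23) K := mon K (A1 ∩ A3) + mon K (A4 ∩ A5) * m2 K

/-- `f_2 = gcd(m_2, m_3) + gcd(m_4, m_5) ⬝ m_1`. -/
noncomputable def f2 : MvPolynomial (Fin 23) K := mon K (A2 ∩ A3) + mon K (A4 ∩ A5) * m1 K

/-- `g_1 = x_16 f_1 f_2` (the variable `x_16` is `X 15`). -/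
noncomputable def g1 : MvPolynomial (Fin 23) K := X 15 * f1 K * f2 K

/-- `g_2 = m_1 f_1 + m_4`. -/
noncomputable def g2 : MvPolynomial (Fin 23) K := m1 K * f1 K + m4 K

/-- `g_3 = m_2 f_2 + m_5`. -/
noncomputable def g3 : MvPolynomial (Fin 23) K := m2 K * f2 K + m5 K

theorem mon_dvd_mon {A B : Finset (Fin 23)} (h : A ⊆ B) : mon K A ∣ mon K B :=
  Finset.prod_dvd_prod_of_subset _ _ _ h

theorem mon_union_dvd (A B : Finset (Fin 23)) : mon K (A ∪ B) ∣ mon K A * mon K B :=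
  ⟨mon K (A ∩ B), (Finset.prod_union_inter).symm⟩

theorem mon_dvd_mul {A B C : Finset (Fin 23)} (h : A ⊆ B ∪ C) :
    mon K A ∣ mon K B * mon K C :=
  (mon_dvd_mon K h).trans (mon_union_dvd K B C)

theorem mon_dvd_mul_mul {A B C D : Finset (Fin 23)} (h : A ⊆ B ∪ C ∪ D) :
    mon K A ∣ mon K B * mon K C * mon K D :=
  (mon_dvd_mul K h).trans (mul_dvd_mul_right (mon_union_dvd K B C) _)

theorem Ideal.IsPrime.mem_of_add_mul_mem {R : Type*} [CommRing R] {P : Ideal R}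
    (hP : P.IsPrime) {a b d e g h k : R} (hga : g ∣ a) (hhb : h ∣ b) (hke : k ∣ e)
    (hd : d ∣ k * b * g) (hf : g + k * b ∈ P) (h₁ : a * (g + k * b) + d ∈ P)
    (h₂ : b * (h + k * a) + e ∈ P) : g ∈ P ∧ b ∈ P ∧ d ∈ P ∧ e ∈ P := by
  have hdP : d ∈ P := (P.add_mem_iff_right (P.mul_mem_left a hf)).1 h₁
  have hg : g ∈ P := by
    refine (hP.mem_or_mem (?_ : g * g ∈ P)).elim id id
    have := P.sub_mem (P.mul_mem_left g hf) (P.mem_of_dvd hd hdP)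
    convert this using 1
    ring
  have hkb : k * b ∈ P := (P.add_mem_iff_right hg).1 hf
  have ha : a ∈ P := P.mem_of_dvd hga hg
  have hbh : b * h + e ∈ P := by
    convert P.sub_mem h₂ (P.mul_mem_left (b * k) ha) using 1
    ring
  rcases hP.mem_or_mem hkb with hk | hb
  · have he : e ∈ P := P.mem_of_dvd hke hk
    have hb : b ∈ P := (hP.mem_or_mem ((P.add_mem_iff_left he).1 hbh)).elim id
      (P.mem_of_dvd hhb)
    exact ⟨hg, hb, hdP, he⟩
  · exact ⟨hg, hb, hdP, (P.add_mem_iff_right (P.mul_mem_right h hb)).1 hbh⟩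

theorem span_g_le_span_m :
    Ideal.span {g1 K, g2 K, g3 K} ≤ Ideal.span {m1 K, m2 K, m3 K, m4 K, m5 K} := by
  set I := Ideal.span {m1 K, m2 K, m3 K, m4 K, m5 K}
  have hm1 : m1 K ∈ I := Ideal.subset_span (by simp)
  have hm2 : m2 K ∈ I := Ideal.subset_span (by simp)
  have hm3 : m3 K ∈ I := Ideal.subset_span (by simp)
  have hm4 : m4 K ∈ I := Ideal.subset_span (by simp)
  have hm5 : m5 K ∈ I := Ideal.subset_span (by simp)
  rw [Ideal.span_le]
  rintro x (rfl | rfl | rfl)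
  · have hdvd : m3 K ∣ X 15 * mon K (A1 ∩ A3) * mon K (A2 ∩ A3) := by
      have h := mon_dvd_mul_mul K (A := A3) (B := {15}) (C := A1 ∩ A3) (D := A2 ∩ A3)
        (by decide)
      simpa [m3, mon] using h
    have key := I.add_mem (I.add_mem (I.mem_of_dvd hdvd hm3)
      (I.mul_mem_left (X 15 * mon K (A4 ∩ A5) * f1 K) hm1))
      (I.mul_mem_left (X 15 * mon K (A4 ∩ A5) * mon K (A2 ∩ A3)) hm2)
    change g1 K ∈ I
    convert key using 1
    simp only [g1, f1, f2]
    ring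
  · exact I.add_mem (I.mul_mem_right _ hm1) hm4
  · exact I.add_mem (I.mul_mem_right _ hm2) hm5

theorem span_m_le_of_isPrime {P : Ideal (MvPolynomial (Fin 23) K)} (hP : P.IsPrime)
    (h₁ : g1 K ∈ P) (h₂ : g2 K ∈ P) (h₃ : g3 K ∈ P) :
    Ideal.span {m1 K, m2 K, m3 K, m4 K, m5 K} ≤ P := by
  suffices h : m1 K ∈ P ∧ m2 K ∈ P ∧ m3 K ∈ P ∧ m4 K ∈ P ∧ m5 K ∈ P by
    obtain ⟨hm1, hm2, hm3, hm4, hm5⟩ := h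
    rw [Ideal.span_le]
    rintro x (rfl | rfl | rfl | rfl | rfl)
    exacts [hm1, hm2, hm3, hm4, hm5]
  have d13 : mon K (A1 ∩ A3) ∣ m1 K := mon_dvd_mon K Finset.inter_subset_left
  have d13' : mon K (A1 ∩ A3) ∣ m3 K := mon_dvd_mon K Finset.inter_subset_right
  have d23 : mon K (A2 ∩ A3) ∣ m2 K := mon_dvd_mon K Finset.inter_subset_left
  have d23' : mon K (A2 ∩ A3) ∣ m3 K := mon_dvd_mon K Finset.inter_subset_right
  have d45 : mon K (A4 ∩ A5) ∣ m4 K := mon_dvd_mon K Finset.inter_subset_left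
  have d45' : mon K (A4 ∩ A5) ∣ m5 K := mon_dvd_mon K Finset.inter_subset_right
  rcases hP.mem_or_mem h₁ with h | hf2
  · rcases hP.mem_or_mem h with hx | hf1
    · have hX {A : Finset (Fin 23)} (hA : (15 : Fin 23) ∈ A) : mon K A ∈ P :=
        P.mem_of_dvd (Finset.dvd_prod_of_mem _ hA) hx
      have hm4 : m4 K ∈ P := hX (by decide)
      have hm5 : m5 K ∈ P := hX (by decide)
      have h45 : mon K (A4 ∩ A5) ∈ P := hX (by decide)
      have mem_of_mul {m g q : MvPolynomial (Fin 23) K} (hg : g ∣ m)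
          (hm : m * (g + mon K (A4 ∩ A5) * q) ∈ P) : m ∈ P :=
        (hP.mem_or_mem hm).elim id fun h =>
          P.mem_of_dvd hg ((P.add_mem_iff_left (P.mul_mem_right _ h45)).1 h)
      exact ⟨mem_of_mul d13 ((P.add_mem_iff_left hm4).1 h₂),
        mem_of_mul d23 ((P.add_mem_iff_left hm5).1 h₃), hX (by decide), hm4, hm5⟩
    · obtain ⟨hg, hm2, hm4, hm5⟩ := hP.mem_of_add_mul_mem d13 d23 d45'
        (mon_dvd_mul_mul K (A := A4) (by decide)) hf1 h₂ h₃
      exact ⟨P.mem_of_dvd d13 hg, hm2, P.mem_of_dvd d13' hg, hm4, hm5⟩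
  · obtain ⟨hg, hm1, hm5, hm4⟩ := hP.mem_of_add_mul_mem d23 d13 d45
      (mon_dvd_mul_mul K (A := A5) (by decide)) hf2 h₃ h₂
    exact ⟨hm1, P.mem_of_dvd d23 hg, P.mem_of_dvd d23' hg, hm4, hm5⟩

theorem radical_span_g_eq :
    (Ideal.span {g1 K, g2 K, g3 K}).radical
      = (Ideal.span {m1 K, m2 K, m3 K, m4 K, m5 K}).radical := by
  refine le_antisymm (Ideal.radical_mono (span_g_le_span_m K)) ?_
  rw [Ideal.radical_le_radical_iff, Ideal.radical_eq_sInf]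
  refine le_sInf fun P ⟨hJ, hP⟩ => ?_
  exact span_m_le_of_isPrime K hP (hJ (Ideal.subset_span (by simp)))
    (hJ (Ideal.subset_span (by simp))) (hJ (Ideal.subset_span (by simp)))

theorem radical_eq_of_J1_case :
    (Ideal.span {g1 K, g2 K, g3 K}).radical
      = (Ideal.span {m1 K, m2 K, m3 K, m4 K, m5 K}).radical ∧
    ara (Ideal.span {m1 K, m2 K, m3 K, m4 K, m5 K} :
      Ideal (MvPolynomial (Fin 23) K)) ≤ 3 := by
  refine ⟨radical_span_g_eq K, Nat.sInf_le ⟨![g1 K, g2 K, g3 K], ?_⟩⟩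
  have hrange : Set.range ![g1 K, g2 K, g3 K] = {g1 K, g2 K, g3 K} := by
    simp only [Matrix.range_cons, Matrix.range_empty, Set.union_empty, Set.singleton_union]
  rw [hrange, radical_span_g_eq]
end

section
/- Let K be a field and let Δ be a simplicial complex on vertex set [n] with Stanley–Reisner ideal I = I_Δ ⊆ S = K[x_1,…,x_n] satisfying arithdeg I ≤ 4 and indeg I ≥ 2. Then there exists a squarefree monomial ideal I' = I_{Δ'} (the Stanley–Reisner ideal of a simplicial complex Δ') such that dim H(I'^∗) ≤ 1 and Δ is obtained from Δ' by recursively adding cones; that is, there is a finite sequence of simplicial complexes Δ' = Δ_0, Δ_1, …, Δ_k = Δ in which each Δ_{t+1} = Δ_t ∪ cone_{u_t}(G_t) for some face G_t of Δ_t and some vertex u_t not in Δ_t. -/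
/-!
Statement 18 (Lemma `claim:red_to_1dim`): let `Δ` be a simplicial complex on
the vertex set `[n]` (every singleton is a face) with Stanley–Reisner ideal
`I = I_Δ ⊆ K[x_1,…,x_n]` satisfying `arithdeg I ≤ 4` (at most four minimal
primes) and `indeg I ≥ 2` (every non-face has at least two elements).  Then
there is a simplicial complex `Δ'` with `dim H(I_{Δ'}^∗) ≤ 1` such that `Δ`
is obtained from `Δ'` by recursively adding cones `Δ_{t+1} = Δ_t ∪ cone_{u_t}(G_t)`
over faces `G_t ∈ Δ_t` from new vertices `u_t ∉ Δ_t`.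

Here the minimal generators of the Alexander dual `I_{Δ'}^∗` are the
monomials `x^{V'∖F}` for the facets `F` of `Δ'` (`V'` the vertex set of
`Δ'`), so the faces of the hypergraph `H(I_{Δ'}^∗)` are the nonempty sets
`{F facet of Δ' | i ∉ F}` for vertices `i ∈ V'`, and `dim H(I_{Δ'}^∗) ≤ 1`
means each of them has at most two elements.
-/

open MvPolynomial

universe u

/-- `Δ` is a (possibly empty) abstract simplicial complex: closed under
taking subsets. -/
def IsComplex {n : ℕ} (Δ : Set (Finset (Fin n))) : Prop :=
  ∀ F ∈ Δ, ∀ G : Finset (Fin n), G ⊆ F → G ∈ Δ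

/-- `F` is a facet (maximal face) of `Δ`. -/
def IsFacet {n : ℕ} (Δ : Set (Finset (Fin n))) (F : Finset (Fin n)) : Prop :=
  F ∈ Δ ∧ ∀ G ∈ Δ, F ⊆ G → F = G

/-- The Stanley–Reisner ideal of `Δ`, generated by the monomials of the
non-faces. -/
noncomputable def SRideal (K : Type u) [Field K] {n : ℕ}
    (Δ : Set (Finset (Fin n))) : Ideal (MvPolynomial (Fin n) K) :=
  Ideal.span ((fun F : Finset (Fin n) => ∏ v ∈ F, (X v : MvPolynomial (Fin n) K)) ''
    {F | F ∉ Δ})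

section Facets

variable {n : ℕ}

theorem exists_facet_superset {Δ : Set (Finset (Fin n))} {H : Finset (Fin n)}
    (hH : H ∈ Δ) : ∃ F, IsFacet Δ F ∧ H ⊆ F := by
  obtain ⟨F, hHF, hF⟩ := Δ.toFinite.exists_le_maximal hH
  exact ⟨F, ⟨hF.prop, fun G hG hFG => hF.eq_of_le hG hFG⟩, hHF⟩

theorem SRideal_le_span_of_mem (K : Type u) [Field K] {Δ : Set (Finset (Fin n))}
    (hΔ : IsComplex Δ) {F : Finset (Fin n)} (hF : F ∈ Δ) :
    SRideal K Δ ≤ Ideal.span (X '' {i : Fin n | i ∉ F}) := by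
  refine Ideal.span_le.2 ?_
  rintro _ ⟨H, hH, rfl⟩
  obtain ⟨v, hvH, hvF⟩ := Finset.not_subset.1 fun h => hH (hΔ F hF H h)
  exact Ideal.mem_of_dvd _ (Finset.dvd_prod_of_mem _ hvH)
    (Ideal.subset_span (Set.mem_image_of_mem X hvF))

/-- A variable lies in the ideal generated by a set of variables only if it is one of them. -/
theorem X_mem_span_X_image_iff (K : Type u) [Field K] {s : Set (Fin n)} {v : Fin n} :
    (X v : MvPolynomial (Fin n) K) ∈ Ideal.span (X '' s) ↔ v ∈ s := by
  classical
  simp [mem_ideal_span_X_image, support_X, Finsupp.single_apply]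

/-- An ideal generated by variables is prime, being the kernel of the endomorphism which sends
these variables to zero. -/
theorem isPrime_span_X_image (K : Type u) [Field K] (s : Set (Fin n)) :
    (Ideal.span (X '' s) : Ideal (MvPolynomial (Fin n) K)).IsPrime := by
  classical
  let P : Ideal (MvPolynomial (Fin n) K) := Ideal.span (X '' s)
  let φ : MvPolynomial (Fin n) K →ₐ[K] MvPolynomial (Fin n) K :=
    aeval fun i => if i ∈ s then 0 else X i
  have hφ : (Ideal.Quotient.mkₐ K P).comp φ = Ideal.Quotient.mkₐ K P := by
    ext i
    by_cases hi : i ∈ s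
    · have hX : Ideal.Quotient.mk P (X i) = 0 :=
        Ideal.Quotient.eq_zero_iff_mem.2 (Ideal.subset_span (Set.mem_image_of_mem X hi))
      simp [φ, hi, hX]
    · simp [φ, hi]
  have hker : P = RingHom.ker φ := by
    refine le_antisymm (Ideal.span_le.2 ?_) fun p hp => ?_
    · rintro _ ⟨i, hi, rfl⟩
      simp [φ, hi]
    · have h := DFunLike.congr_fun hφ p
      rw [AlgHom.comp_apply, (RingHom.mem_ker).1 hp, map_zero] at h
      exact Ideal.Quotient.eq_zero_iff_mem.1 h.symm
  change P.IsPrime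
  rw [hker]
  exact RingHom.ker_isPrime φ

theorem IsFacet.span_mem_minimalPrimes (K : Type u) [Field K] {Δ : Set (Finset (Fin n))}
    (hΔ : IsComplex Δ) {F : Finset (Fin n)} (hF : IsFacet Δ F) :
    Ideal.span (X '' {i : Fin n | i ∉ F}) ∈ (SRideal K Δ).minimalPrimes := by
  refine ⟨⟨isPrime_span_X_image K _, SRideal_le_span_of_mem K hΔ hF.1⟩, ?_⟩
  rintro Q ⟨hQ, hIQ⟩ hQF
  refine Ideal.span_le.2 ?_
  rintro _ ⟨i, hi, rfl⟩
  have hnon : insert i F ∉ Δ := fun h => hi <| by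
    rw [hF.2 _ h (Finset.subset_insert i F)]
    exact Finset.mem_insert_self i F
  have hmem : ∏ v ∈ insert i F, (X v : MvPolynomial (Fin n) K) ∈ Q :=
    hIQ (Ideal.subset_span ⟨_, hnon, rfl⟩)
  obtain ⟨v, hv, hvQ⟩ := (hQ.prod_mem_iff).1 hmem
  rcases Finset.mem_insert.1 hv with rfl | hvF
  · exact hvQ
  · exact absurd hvF ((X_mem_span_X_image_iff K).1 (hQF hvQ))

/-- The number of facets is at most the number of minimal primes of the Stanley–Reisner ideal. -/
theorem ncard_facets_le_ncard_minimalPrimes (K : Type u) [Field K]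
    {Δ : Set (Finset (Fin n))} (hΔ : IsComplex Δ) :
    {F | IsFacet Δ F}.ncard ≤ (SRideal K Δ).minimalPrimes.ncard := by
  refine Set.ncard_le_ncard_of_injOn
    (fun F => Ideal.span (X '' {i : Fin n | i ∉ F}))
    (fun F hF => IsFacet.span_mem_minimalPrimes K hΔ hF) ?_
    (Ideal.finite_minimalPrimes_of_isNoetherianRing _ _)
  intro F _ G _ hFG
  ext v
  have h := (X_mem_span_X_image_iff K (s := {i | i ∉ F}) (v := v)).symm.trans <|
    (iff_of_eq (congrArg (X v ∈ ·) hFG)).trans (X_mem_span_X_image_iff K)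
  exact not_iff_not.1 h

theorem IsComplex.deletion {Δ : Set (Finset (Fin n))} (hΔ : IsComplex Δ) (u : Fin n) :
    IsComplex {H | H ∈ Δ ∧ u ∉ H} :=
  fun F hF G hGF => ⟨hΔ F hF.1 G hGF, fun h => hF.2 (hGF h)⟩

theorem IsComplex.ncard_facets_deletion_le {Δ : Set (Finset (Fin n))} (hΔ : IsComplex Δ)
    (u : Fin n) :
    {F | IsFacet {H | H ∈ Δ ∧ u ∉ H} F}.ncard ≤ {F | IsFacet Δ F}.ncard := by
  refine (Set.ncard_le_ncard ?_ (Set.toFinite _)).trans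
    (Set.ncard_image_le (f := fun F => F.erase u) (Set.toFinite _))
  intro H hH
  obtain ⟨F, hF, hHF⟩ := exists_facet_superset hH.1.1
  refine ⟨F, hF, (hH.2 _ ⟨hΔ F hF.1 _ (F.erase_subset u), F.notMem_erase u⟩ ?_).symm⟩
  exact Finset.subset_erase.2 ⟨hHF, hH.1.2⟩

/-- If `u` lies in exactly one facet `F`, then `Δ` is its deletion at `u` with a cone added. -/
theorem IsComplex.eq_deletion_union_cone {Δ : Set (Finset (Fin n))} (hΔ : IsComplex Δ)
    {u : Fin n} {F : Finset (Fin n)} (hF : F ∈ Δ) (huF : u ∈ F)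
    (hunique : ∀ G, IsFacet Δ G → u ∈ G → G = F) :
    Δ = {H | H ∈ Δ ∧ u ∉ H} ∪ {H | H ⊆ insert u (F.erase u)} := by
  rw [Finset.insert_erase huF]
  ext H
  constructor
  · intro hH
    by_cases huH : u ∈ H
    · obtain ⟨G, hG, hHG⟩ := exists_facet_superset hH
      exact Or.inr (hunique G hG (hHG huH) ▸ hHG)
    · exact Or.inl ⟨hH, huH⟩
  · rintro (hH | hH)
    · exact hH.1
    · exact hΔ F hF H hH

/-- If every vertex lies in two facets and there are at most four facets, then every vertex is
missed by at most two facets. -/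
theorem ncard_facets_notMem_le_two {Δ : Set (Finset (Fin n))}
    (hcard : {F | IsFacet Δ F}.ncard ≤ 4) {i : Fin n} {F G : Finset (Fin n)}
    (hF : IsFacet Δ F) (hG : IsFacet Δ G) (hiF : i ∈ F) (hiG : i ∈ G) (hne : G ≠ F) :
    {F | IsFacet Δ F ∧ i ∉ F}.ncard ≤ 2 := by
  have hdisj : Disjoint {F | IsFacet Δ F ∧ i ∉ F} {G, F} := by
    rw [Set.disjoint_left]
    rintro H ⟨-, hiH⟩ (rfl | rfl)
    exacts [hiH hiG, hiH hiF]
  have hsub : {F | IsFacet Δ F ∧ i ∉ F} ∪ {G, F} ⊆ {F | IsFacet Δ F} := by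
    rintro H (hH | rfl | rfl)
    exacts [hH.1, hG, hF]
  have hle := Set.ncard_le_ncard hsub (Set.toFinite _)
  rw [Set.ncard_union_eq hdisj (Set.toFinite _) (Set.toFinite _), Set.ncard_pair hne] at hle
  omega

/-- A complex with at most four facets is obtained by adding cones to a complex each of whose
vertices is missed by at most two facets. -/
theorem IsComplex.exists_cone_sequence {Δ : Set (Finset (Fin n))} (hΔ : IsComplex Δ)
    (hcard : {F | IsFacet Δ F}.ncard ≤ 4) :
    ∃ Δ' : Set (Finset (Fin n)),
      IsComplex Δ' ∧
      (∀ i : Fin n, ({i} : Finset (Fin n)) ∈ Δ' →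
        {F : Finset (Fin n) | IsFacet Δ' F ∧ i ∉ F}.ncard ≤ 2) ∧
      ∃ (k : ℕ) (D : Fin (k + 1) → Set (Finset (Fin n))),
        D 0 = Δ' ∧ D (Fin.last k) = Δ ∧
        ∀ t : Fin k, ∃ (u : Fin n) (G : Finset (Fin n)),
          G ∈ D t.castSucc ∧
          (∀ F ∈ D t.castSucc, u ∉ F) ∧
          D t.succ = D t.castSucc ∪ {H : Finset (Fin n) | H ⊆ insert u G} := by
  induction hm : Δ.ncard using Nat.strong_induction_on generalizing Δ with
  | _ m ih =>
  subst hm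
  by_cases hfree : ∃ u F, IsFacet Δ F ∧ u ∈ F ∧ ∀ G, IsFacet Δ G → u ∈ G → G = F
  · obtain ⟨u, F, hF, huF, hunique⟩ := hfree
    have hlt : {H | H ∈ Δ ∧ u ∉ H}.ncard < Δ.ncard :=
      Set.ncard_lt_ncard ⟨fun H hH => hH.1, fun h => (h hF.1).2 huF⟩ Δ.toFinite
    obtain ⟨Δ', hΔ', hdim, k, D, hD0, hDlast, hDstep⟩ :=
      ih _ hlt (hΔ.deletion u) ((hΔ.ncard_facets_deletion_le u).trans hcard) rfl
    refine ⟨Δ', hΔ', hdim, k + 1, Fin.snoc (α := fun _ => Set (Finset (Fin n))) D Δ,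
      ?_, Fin.snoc_last _ _, fun t => ?_⟩
    · rw [← Fin.castSucc_zero, Fin.snoc_castSucc, hD0]
    · rw [Fin.snoc_castSucc]
      refine Fin.lastCases ?_ (fun t => ?_) t
      · refine ⟨u, F.erase u, ?_, ?_, ?_⟩
        · rw [hDlast]
          exact ⟨hΔ F hF.1 _ (F.erase_subset u), F.notMem_erase u⟩
        · rw [hDlast]
          exact fun H hH => hH.2
        · rw [Fin.succ_last, Fin.snoc_last, hDlast]
          exact hΔ.eq_deletion_union_cone hF.1 huF hunique
      · rw [Fin.succ_castSucc, Fin.snoc_castSucc]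
        exact hDstep t
  · push Not at hfree
    refine ⟨Δ, hΔ, fun i hi => ?_, 0, fun _ => Δ, rfl, rfl, fun t => t.elim0⟩
    obtain ⟨F, hF, hiF⟩ := exists_facet_superset hi
    rw [Finset.singleton_subset_iff] at hiF
    obtain ⟨G, hG, hiG, hne⟩ := hfree i F hF hiF
    exact ncard_facets_notMem_le_two hcard hF hG hiF hiG hne

end Facets

theorem reduction_to_one_dimensional_dual_hypergraph
    (K : Type u) [Field K] (n : ℕ) (Δ : Set (Finset (Fin n)))
    (hΔ : IsComplex Δ)
    (hvert : ∀ v : Fin n, ({v} : Finset (Fin n)) ∈ Δ)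
    (I : Ideal (MvPolynomial (Fin n) K)) (hI : I = SRideal K Δ)
    (harithdeg : (I.minimalPrimes).ncard ≤ 4)
    (hindeg : ∀ F : Finset (Fin n), F ∉ Δ → 2 ≤ F.card) :
    ∃ Δ' : Set (Finset (Fin n)),
      IsComplex Δ' ∧
      -- `dim H(I_{Δ'}^∗) ≤ 1`:
      (∀ i : Fin n, ({i} : Finset (Fin n)) ∈ Δ' →
        {F : Finset (Fin n) | IsFacet Δ' F ∧ i ∉ F}.ncard ≤ 2) ∧
      -- `Δ` is obtained from `Δ'` by recursively adding cones:
      ∃ (k : ℕ) (D : Fin (k + 1) → Set (Finset (Fin n))),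
        D 0 = Δ' ∧ D (Fin.last k) = Δ ∧
        ∀ t : Fin k, ∃ (u : Fin n) (G : Finset (Fin n)),
          G ∈ D t.castSucc ∧
          (∀ F ∈ D t.castSucc, u ∉ F) ∧
          D t.succ = D t.castSucc ∪ {H : Finset (Fin n) | H ⊆ insert u G} := by
  subst hI
  exact hΔ.exists_cone_sequence ((ncard_facets_le_ncard_minimalPrimes K hΔ).trans harithdeg)
end
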